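/- arXiv:2206.12524 — 2 statements merged into one kernel-verified Lean document; each statement's English description precedes it below -/
import Mathlib

section
/- Classification of closed connected quartic GPSR curves (existence and uniqueness): Let h : ℝ² → ℝ be a homogeneous quartic polynomial, let p₀ ∈ ℝ² satisfy h(p₀) = 1 and det(Hess h)(p₀) < 0, and let H be the connected component of {p ∈ ℝ² : h(p) = 1 and det(Hess h)(p) < 0} containing p₀. If H is closed as a subset of ℝ², then there is exactly one curve M from the following list for which there exists A ∈ GL(2,ℝ) with A(M) = H: (a) M = H_{0,1/4}; (b) M = H_{2√2/(3√3), −1/12}; (c) M = H_{2/(3√3), 0}; (d) M = H_{0,K} for some K < 1/4. (Exactly one means: such M and A exist, and if M, M′ are two curves from this list each mapped onto H by some element of GL(2,ℝ), then M = M′.) -/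
/-!
Common definitions: the quartic polynomial `hLK L K (x,y) = x⁴ − x²y² + L·x·y³ + K·y⁴` on ℝ²,
the Hessian determinant of a function on ℝ², and the curve `Hcurve L K = H_{L,K}`,
the connected component containing (1,0) of the hyperbolic points on the level set {h = 1}.
-/

noncomputable section
open Matrix

/-- `h_{L,K}(x,y) = x⁴ − x²y² + L·x·y³ + K·y⁴`. -/
def hLK (L K : ℝ) (v : Fin 2 → ℝ) : ℝ :=
  v 0 ^ 4 - v 0 ^ 2 * v 1 ^ 2 + L * v 0 * v 1 ^ 3 + K * v 1 ^ 4

/-- Determinant of the Hessian matrix of `f : ℝ² → ℝ` at `p`. -/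
def hessDet2 (f : (Fin 2 → ℝ) → ℝ) (p : Fin 2 → ℝ) : ℝ :=
  Matrix.det (Matrix.of fun i j : Fin 2 =>
    iteratedFDeriv ℝ 2 f p ![Pi.single i 1, Pi.single j 1])

/-- `H_{L,K}`: the connected component containing `(1,0)` of
`{p ∈ ℝ² : h_{L,K}(p) = 1 and p is a hyperbolic point of h_{L,K}}`. -/
def Hcurve (L K : ℝ) : Set (Fin 2 → ℝ) :=
  connectedComponentIn {p | hLK L K p = 1 ∧ hessDet2 (hLK L K) p < 0} ![1, 0]

/-- The binary quartic form with coefficients `a, b, c, d, e`. -/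
def binaryQuartic (a b c d e : ℝ) (v : Fin 2 → ℝ) : ℝ :=
  a * v 0 ^ 4 + b * v 0 ^ 3 * v 1 + c * v 0 ^ 2 * v 1 ^ 2 + d * v 0 * v 1 ^ 3 + e * v 1 ^ 4

/-- The Hessian determinant of `binaryQuartic a b c d e` at `(x, y)`. -/
def hessQuartic (a b c d e x y : ℝ) : ℝ :=
  (12 * a * x ^ 2 + 6 * b * x * y + 2 * c * y ^ 2) *
    (2 * c * x ^ 2 + 6 * d * x * y + 12 * e * y ^ 2) -
    (3 * b * x ^ 2 + 4 * c * x * y + 3 * d * y ^ 2) ^ 2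

theorem hessDet2_binaryQuartic (a b c d e : ℝ) (p : Fin 2 → ℝ) :
    hessDet2 (binaryQuartic a b c d e) p = hessQuartic a b c d e (p 0) (p 1) := by
  have hπ (i : Fin 2) (v : Fin 2 → ℝ) : HasFDerivAt (fun v : Fin 2 → ℝ => v i)
      (ContinuousLinearMap.proj (R := ℝ) (φ := fun _ : Fin 2 => ℝ) i) v :=
    (ContinuousLinearMap.proj (R := ℝ) (φ := fun _ : Fin 2 => ℝ) i).hasFDerivAt
  set P := ContinuousLinearMap.proj (R := ℝ) (φ := fun _ : Fin 2 => ℝ) with hP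
  have h1 : fderiv ℝ (binaryQuartic a b c d e) = fun v =>
      (4 * a * v 0 ^ 3 + 3 * b * v 0 ^ 2 * v 1 + 2 * c * v 0 * v 1 ^ 2 + d * v 1 ^ 3) • P 0 +
      (b * v 0 ^ 3 + 2 * c * v 0 ^ 2 * v 1 + 3 * d * v 0 * v 1 ^ 2 + 4 * e * v 1 ^ 3) • P 1 := by
    funext v
    refine HasFDerivAt.fderiv ?_
    have := (((((hπ 0 v).pow 4).const_mul a).add ((((hπ 0 v).pow 3).const_mul b).mul (hπ 1 v))).add
      ((((hπ 0 v).pow 2).const_mul c).mul ((hπ 1 v).pow 2))).add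
      ((((hπ 0 v).const_mul d).mul ((hπ 1 v).pow 3))) |>.add (((hπ 1 v).pow 4).const_mul e)
    refine this.congr_fderiv ?_
    ext w
    simp [hP]
    ring
  have h2 : HasFDerivAt (fderiv ℝ (binaryQuartic a b c d e))
      (((12 * a * p 0 ^ 2 + 6 * b * p 0 * p 1 + 2 * c * p 1 ^ 2) • P 0 +
        (3 * b * p 0 ^ 2 + 4 * c * p 0 * p 1 + 3 * d * p 1 ^ 2) • P 1).smulRight (P 0) +
       ((3 * b * p 0 ^ 2 + 4 * c * p 0 * p 1 + 3 * d * p 1 ^ 2) • P 0 +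
        (2 * c * p 0 ^ 2 + 6 * d * p 0 * p 1 + 12 * e * p 1 ^ 2) • P 1).smulRight (P 1)) p := by
    have hA : HasFDerivAt (fun v : Fin 2 → ℝ =>
        4 * a * v 0 ^ 3 + 3 * b * v 0 ^ 2 * v 1 + 2 * c * v 0 * v 1 ^ 2 + d * v 1 ^ 3)
        ((12 * a * p 0 ^ 2 + 6 * b * p 0 * p 1 + 2 * c * p 1 ^ 2) • P 0 +
          (3 * b * p 0 ^ 2 + 4 * c * p 0 * p 1 + 3 * d * p 1 ^ 2) • P 1) p := by
      have := (((((hπ 0 p).pow 3).const_mul (4 * a))).add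
        ((((hπ 0 p).pow 2).const_mul (3 * b)).mul (hπ 1 p))).add
        ((((hπ 0 p)).const_mul (2 * c)).mul ((hπ 1 p).pow 2)) |>.add (((hπ 1 p).pow 3).const_mul d)
      refine this.congr_fderiv ?_
      ext w
      simp [hP]
      ring
    have hB : HasFDerivAt (fun v : Fin 2 → ℝ =>
        b * v 0 ^ 3 + 2 * c * v 0 ^ 2 * v 1 + 3 * d * v 0 * v 1 ^ 2 + 4 * e * v 1 ^ 3)
        ((3 * b * p 0 ^ 2 + 4 * c * p 0 * p 1 + 3 * d * p 1 ^ 2) • P 0 +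
          (2 * c * p 0 ^ 2 + 6 * d * p 0 * p 1 + 12 * e * p 1 ^ 2) • P 1) p := by
      have := (((((hπ 0 p).pow 3).const_mul b)).add
        ((((hπ 0 p).pow 2).const_mul (2 * c)).mul (hπ 1 p))).add
        ((((hπ 0 p)).const_mul (3 * d)).mul ((hπ 1 p).pow 2)) |>.add
        (((hπ 1 p).pow 3).const_mul (4 * e))
      refine this.congr_fderiv ?_
      ext w
      simp [hP]
      ring
    rw [h1]
    have hA' := hA.smul_const (P 0)
    have hB' := hB.smul_const (P 1)
    exact hA'.add hB'
  simp only [hessDet2, Matrix.det_fin_two, Matrix.of_apply, iteratedFDeriv_two_apply, h2.fderiv]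
  simp [hP, hessQuartic]
  ring

theorem exists_eq_binaryQuartic {P : MvPolynomial (Fin 2) ℝ} (hP : P.IsHomogeneous 4) :
    ∃ a b c d e, (fun v => MvPolynomial.eval v P) = binaryQuartic a b c d e := by
  classical
  let m : ℕ → Fin 2 →₀ ℕ := fun i => Finsupp.single 0 i + Finsupp.single 1 (4 - i)
  have hm : Set.InjOn m (Finset.range 5) := by
    intro i _ j _ hij
    simpa [m] using DFunLike.congr_fun hij 0
  have hsub : P.support ⊆ (Finset.range 5).image m := by
    intro s hs
    have h4 : s 0 + s 1 = 4 := by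
      have := hP (MvPolynomial.mem_support_iff.1 hs)
      simpa [Finsupp.weight_apply, Finsupp.sum_fintype] using this
    refine Finset.mem_image.2 ⟨s 0, by simp; omega, ?_⟩
    ext i
    fin_cases i
    · simp [m]
    · simp [m]; omega
  refine ⟨P.coeff (m 4), P.coeff (m 3), P.coeff (m 2), P.coeff (m 1), P.coeff (m 0), ?_⟩
  funext v
  rw [MvPolynomial.eval_eq', Finset.sum_subset hsub, Finset.sum_image hm]
  · simp [Finset.sum_range_succ, m, binaryQuartic]
    ring
  · intro s _ hs
    simp [MvPolynomial.notMem_support_iff.1 hs]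

/-- `h` is given by a binary quartic form. -/
def IsBinaryQuartic (h : (Fin 2 → ℝ) → ℝ) : Prop :=
  ∃ a b c d e, h = binaryQuartic a b c d e

theorem binaryQuartic_mulVec (a b c d e : ℝ) (A : Matrix (Fin 2) (Fin 2) ℝ) :
    (fun v => binaryQuartic a b c d e (A *ᵥ v)) = binaryQuartic
      (a * A 0 0 ^ 4 + b * A 0 0 ^ 3 * A 1 0 + c * A 0 0 ^ 2 * A 1 0 ^ 2 +
        d * A 0 0 * A 1 0 ^ 3 + e * A 1 0 ^ 4)
      (4 * a * A 0 0 ^ 3 * A 0 1 + b * (3 * A 0 0 ^ 2 * A 0 1 * A 1 0 + A 0 0 ^ 3 * A 1 1) +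
        c * (2 * A 0 0 * A 0 1 * A 1 0 ^ 2 + 2 * A 0 0 ^ 2 * A 1 0 * A 1 1) +
        d * (A 0 1 * A 1 0 ^ 3 + 3 * A 0 0 * A 1 0 ^ 2 * A 1 1) + 4 * e * A 1 0 ^ 3 * A 1 1)
      (6 * a * A 0 0 ^ 2 * A 0 1 ^ 2 +
        b * (3 * A 0 0 * A 0 1 ^ 2 * A 1 0 + 3 * A 0 0 ^ 2 * A 0 1 * A 1 1) +
        c * (A 0 1 ^ 2 * A 1 0 ^ 2 + 4 * A 0 0 * A 0 1 * A 1 0 * A 1 1 + A 0 0 ^ 2 * A 1 1 ^ 2) +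
        d * (3 * A 0 1 * A 1 0 ^ 2 * A 1 1 + 3 * A 0 0 * A 1 0 * A 1 1 ^ 2) +
        6 * e * A 1 0 ^ 2 * A 1 1 ^ 2)
      (4 * a * A 0 0 * A 0 1 ^ 3 + b * (A 0 1 ^ 3 * A 1 0 + 3 * A 0 0 * A 0 1 ^ 2 * A 1 1) +
        c * (2 * A 0 1 ^ 2 * A 1 0 * A 1 1 + 2 * A 0 0 * A 0 1 * A 1 1 ^ 2) +
        d * (3 * A 0 1 * A 1 0 * A 1 1 ^ 2 + A 0 0 * A 1 1 ^ 3) + 4 * e * A 1 0 * A 1 1 ^ 3)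
      (a * A 0 1 ^ 4 + b * A 0 1 ^ 3 * A 1 1 + c * A 0 1 ^ 2 * A 1 1 ^ 2 +
        d * A 0 1 * A 1 1 ^ 3 + e * A 1 1 ^ 4) := by
  funext v
  simp only [binaryQuartic, Matrix.mulVec, dotProduct, Fin.sum_univ_two]
  ring

theorem hLK_eq_binaryQuartic (L K : ℝ) : hLK L K = binaryQuartic 1 0 (-1) L K := by
  funext v
  simp only [hLK, binaryQuartic]
  ring

theorem isBinaryQuartic_hLK (L K : ℝ) : IsBinaryQuartic (hLK L K) :=
  ⟨_, _, _, _, _, hLK_eq_binaryQuartic L K⟩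

namespace IsBinaryQuartic

variable {h : (Fin 2 → ℝ) → ℝ}

theorem comp_mulVec (hh : IsBinaryQuartic h) (A : Matrix (Fin 2) (Fin 2) ℝ) :
    IsBinaryQuartic fun v => h (A *ᵥ v) := by
  obtain ⟨a, b, c, d, e, rfl⟩ := hh
  exact ⟨_, _, _, _, _, binaryQuartic_mulVec a b c d e A⟩

theorem hessDet2_comp_mulVec (hh : IsBinaryQuartic h) (A : Matrix (Fin 2) (Fin 2) ℝ)
    (v : Fin 2 → ℝ) :
    hessDet2 (fun v => h (A *ᵥ v)) v = A.det ^ 2 * hessDet2 h (A *ᵥ v) := by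
  obtain ⟨a, b, c, d, e, rfl⟩ := hh
  rw [binaryQuartic_mulVec, hessDet2_binaryQuartic, hessDet2_binaryQuartic]
  simp only [hessQuartic, Matrix.mulVec, dotProduct, Fin.sum_univ_two, Matrix.det_fin_two]
  ring

theorem continuous (hh : IsBinaryQuartic h) : Continuous h := by
  obtain ⟨a, b, c, d, e, rfl⟩ := hh
  unfold binaryQuartic
  fun_prop

theorem continuous_hessDet2 (hh : IsBinaryQuartic h) : Continuous (hessDet2 h) := by
  obtain ⟨a, b, c, d, e, rfl⟩ := hh
  rw [funext (hessDet2_binaryQuartic a b c d e)]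
  unfold hessQuartic
  fun_prop

theorem apply_smul (hh : IsBinaryQuartic h) (r : ℝ) (v : Fin 2 → ℝ) :
    h (r • v) = r ^ 4 * h v := by
  obtain ⟨a, b, c, d, e, rfl⟩ := hh
  simp only [binaryQuartic, Pi.smul_apply, smul_eq_mul]
  ring

theorem hessDet2_smul (hh : IsBinaryQuartic h) (r : ℝ) (v : Fin 2 → ℝ) :
    hessDet2 h (r • v) = r ^ 4 * hessDet2 h v := by
  obtain ⟨a, b, c, d, e, rfl⟩ := hh
  simp only [hessDet2_binaryQuartic, hessQuartic, Pi.smul_apply, smul_eq_mul]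
  ring

end IsBinaryQuartic

/-- The hyperbolic points of the level set `{h = 1}`. -/
def hypLevel (h : (Fin 2 → ℝ) → ℝ) : Set (Fin 2 → ℝ) :=
  {p | h p = 1 ∧ hessDet2 h p < 0}

theorem hcurve_eq (L K : ℝ) :
    Hcurve L K = connectedComponentIn (hypLevel (hLK L K)) ![1, 0] := rfl

theorem mulVec_inv_mulVec {A : Matrix (Fin 2) (Fin 2) ℝ} (hA : IsUnit A) (v : Fin 2 → ℝ) :
    A *ᵥ (A⁻¹ *ᵥ v) = v := by
  rw [Matrix.mulVec_mulVec, Matrix.mul_nonsing_inv _ ((Matrix.isUnit_iff_isUnit_det A).1 hA),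
    Matrix.one_mulVec]

theorem inv_mulVec_mulVec {A : Matrix (Fin 2) (Fin 2) ℝ} (hA : IsUnit A) (v : Fin 2 → ℝ) :
    A⁻¹ *ᵥ (A *ᵥ v) = v := by
  rw [Matrix.mulVec_mulVec, Matrix.nonsing_inv_mul _ ((Matrix.isUnit_iff_isUnit_det A).1 hA),
    Matrix.one_mulVec]

/-- The homeomorphism of the plane given by an invertible matrix. -/
def mulVecHomeomorph (A : Matrix (Fin 2) (Fin 2) ℝ) (hA : IsUnit A) :
    (Fin 2 → ℝ) ≃ₜ (Fin 2 → ℝ) where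
  toFun := A.mulVec
  invFun := A⁻¹.mulVec
  left_inv := inv_mulVec_mulVec hA
  right_inv := mulVec_inv_mulVec hA
  continuous_toFun := by fun_prop
  continuous_invFun := by fun_prop

namespace IsBinaryQuartic

variable {h : (Fin 2 → ℝ) → ℝ}

theorem mem_hypLevel_comp_iff (hh : IsBinaryQuartic h) {A : Matrix (Fin 2) (Fin 2) ℝ}
    (hA : IsUnit A) (v : Fin 2 → ℝ) :
    v ∈ hypLevel (fun v => h (A *ᵥ v)) ↔ A *ᵥ v ∈ hypLevel h := by
  have hdet0 : A.det ≠ 0 := ((Matrix.isUnit_iff_isUnit_det A).1 hA).ne_zero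
  have hdet : 0 < A.det ^ 2 := by positivity
  simp only [hypLevel, Set.mem_ofPred_eq, hh.hessDet2_comp_mulVec, mul_neg_iff, hdet,
    hdet.not_gt, true_and, false_and, or_false]

theorem image_connectedComponentIn (hh : IsBinaryQuartic h) {A : Matrix (Fin 2) (Fin 2) ℝ}
    (hA : IsUnit A) {p : Fin 2 → ℝ} (hp : A *ᵥ p ∈ hypLevel h) :
    A.mulVec '' connectedComponentIn (hypLevel fun v => h (A *ᵥ v)) p =
      connectedComponentIn (hypLevel h) (A *ᵥ p) := by
  have hp' := (hh.mem_hypLevel_comp_iff hA p).2 hp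
  have himg : A.mulVec '' hypLevel (fun v => h (A *ᵥ v)) = hypLevel h := by
    ext v
    constructor
    · rintro ⟨w, hw, rfl⟩
      exact (hh.mem_hypLevel_comp_iff hA w).1 hw
    · intro hv
      refine ⟨A⁻¹ *ᵥ v, (hh.mem_hypLevel_comp_iff hA _).2 ?_, mulVec_inv_mulVec hA v⟩
      rwa [mulVec_inv_mulVec hA]
  have := (mulVecHomeomorph A hA).image_connectedComponentIn hp'
  change A.mulVec '' _ = connectedComponentIn (A.mulVec '' _) (A *ᵥ p) at this
  rw [this, himg]

/-- Radial projection to the level set `{h = 1}` maps a preconnected set of hyperbolic points at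
which `h` is positive into a single connected component of `hypLevel h`. -/
theorem smul_mem_connectedComponentIn (hh : IsBinaryQuartic h) {U : Set (Fin 2 → ℝ)}
    (hU : IsPreconnected U) (hpos : ∀ v ∈ U, 0 < h v) (hneg : ∀ v ∈ U, hessDet2 h v < 0)
    {p : Fin 2 → ℝ} (hpU : p ∈ U) (hp : h p = 1) {v : Fin 2 → ℝ} (hv : v ∈ U) :
    h v ^ (-(1 / 4) : ℝ) • v ∈ connectedComponentIn (hypLevel h) p := by
  let N : (Fin 2 → ℝ) → (Fin 2 → ℝ) := fun v => h v ^ (-(1 / 4) : ℝ) • v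
  have hN : ContinuousOn N U := by
    have hr : ContinuousOn (fun w => h w ^ (-(1 / 4) : ℝ)) U :=
      hh.continuous.continuousOn.rpow_const fun w hw => Or.inl (hpos w hw).ne'
    exact hr.smul continuousOn_id
  have hpow (w) (hw : w ∈ U) : (h w ^ (-(1 / 4) : ℝ)) ^ 4 = (h w)⁻¹ := by
    rw [← Real.rpow_natCast, ← Real.rpow_mul (hpos w hw).le, ← Real.rpow_neg_one]
    norm_num
  have hsub : N '' U ⊆ hypLevel h := by
    rintro _ ⟨w, hw, rfl⟩
    have hw0 := hpos w hw
    refine ⟨?_, ?_⟩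
    · simp only [N]
      rw [hh.apply_smul, hpow w hw, inv_mul_cancel₀ hw0.ne']
    · simp only [N]
      rw [hh.hessDet2_smul, hpow w hw]
      exact mul_neg_of_pos_of_neg (inv_pos.2 hw0) (hneg w hw)
  have hpN : p ∈ N '' U := ⟨p, hpU, by simp [N, hp]⟩
  exact (hU.image N hN).subset_connectedComponentIn hpN hsub ⟨v, hv, rfl⟩

end IsBinaryQuartic

theorem not_forall_pos_and_hessQuartic_neg {c d e : ℝ} (hc : c < 0) :
    ¬ ∀ t : ℝ, 0 ≤ t → 0 < binaryQuartic 1 0 c d e ![1, t] ∧ hessQuartic 1 0 c d e 1 t < 0 := by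
  intro H
  set g : ℝ → ℝ := fun t => 1 + c * t ^ 2 + d * t ^ 3 + e * t ^ 4 with hg
  set g₁ : ℝ → ℝ := fun t => 2 * c * t + 3 * d * t ^ 2 + 4 * e * t ^ 3 with hg₁
  set g₂ : ℝ → ℝ := fun t => 2 * c + 6 * d * t + 12 * e * t ^ 2 with hg₂
  have hgd (t : ℝ) : HasDerivAt g (g₁ t) t := by
    have := ((((hasDerivAt_id t).pow 2).const_mul c).const_add 1).add
      (((hasDerivAt_id t).pow 3).const_mul d) |>.add (((hasDerivAt_id t).pow 4).const_mul e)
    refine this.congr_deriv ?_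
    simp [hg₁]
    ring
  have hg₁d (t : ℝ) : HasDerivAt g₁ (g₂ t) t := by
    have := (((hasDerivAt_id t).const_mul (2 * c))).add
      (((hasDerivAt_id t).pow 2).const_mul (3 * d)) |>.add
      (((hasDerivAt_id t).pow 3).const_mul (4 * e))
    refine this.congr_deriv ?_
    simp [hg₂]
    ring
  have hpos (t : ℝ) (ht : 0 ≤ t) : 0 < g t := by
    have := (H t ht).1
    simpa [binaryQuartic, hg] using this
  have hneg (t : ℝ) (ht : 0 ≤ t) : g₂ t * g t - g₁ t * g₁ t < 0 := by
    have h1 := (H t ht).2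
    have h2 : hessQuartic 1 0 c d e 1 t = 12 * (g₂ t * g t) - 9 * (g₁ t * g₁ t) := by
      simp only [hessQuartic, hg, hg₁, hg₂]
      ring
    nlinarith [mul_self_nonneg (g₁ t)]
  have hlog (t : ℝ) (ht : 0 ≤ t) :
      HasDerivAt (fun t => g₁ t / g t) ((g₂ t * g t - g₁ t * g₁ t) / g t ^ 2) t :=
    (hg₁d t).div (hgd t) (hpos t ht).ne'
  have hanti : StrictAntiOn (fun t => g₁ t / g t) (Set.Ici 0) := by
    refine strictAntiOn_of_deriv_neg (convex_Ici 0)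
      (fun t ht => (hlog t ht).continuousAt.continuousWithinAt) fun t ht => ?_
    have ht : 0 ≤ t := interior_subset ht
    rw [(hlog t ht).deriv]
    exact div_neg_of_neg_of_pos (hneg t ht) (pow_pos (hpos t ht) 2)
  have hganti : AntitoneOn g (Set.Ici 0) := by
    refine antitoneOn_of_deriv_nonpos (convex_Ici 0)
      (fun t _ => (hgd t).continuousAt.continuousWithinAt)
      (fun t _ => (hgd t).differentiableAt.differentiableWithinAt) fun t ht => ?_
    have ht : 0 ≤ t := interior_subset ht
    have h1 := hanti.antitoneOn (Set.mem_Ici.2 le_rfl) ht ht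
    have h0 : g₁ 0 = 0 := by simp [hg₁]
    simp only [h0, zero_div] at h1
    rw [(hgd t).deriv]
    by_contra! h2
    exact absurd h1 (not_le.2 (div_pos h2 (hpos t ht)))
  have hdeg : (Polynomial.C 1 + Polynomial.C c * Polynomial.X ^ 2 +
      Polynomial.C d * Polynomial.X ^ 3 + Polynomial.C e * Polynomial.X ^ 4).degree ≤ 0 := by
    rw [← Polynomial.isBoundedUnder_abs_atTop_iff]
    refine Filter.isBoundedUnder_of_eventually_le (a := 1) ?_
    filter_upwards [Filter.eventually_ge_atTop 0] with t ht
    have h1 := hganti (Set.mem_Ici.2 le_rfl) ht ht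
    have h2 := hpos t ht
    have h0 : g 0 = 1 := by simp [hg]
    have h3 : Polynomial.eval t (Polynomial.C 1 + Polynomial.C c * Polynomial.X ^ 2 +
      Polynomial.C d * Polynomial.X ^ 3 + Polynomial.C e * Polynomial.X ^ 4) = g t := by
      simp [hg]
    rw [h3, abs_of_pos h2]
    linarith
  have hcoeff := Polynomial.coeff_eq_zero_of_degree_lt
    (hdeg.trans_lt (by norm_num : (0 : WithBot ℕ) < (2 : ℕ)))
  simp [Polynomial.coeff_X_pow, Polynomial.coeff_one] at hcoeff
  exact hc.ne hcoeff

/-- Following a closed component along the rays through `(1, s)`, `s ≥ 0`, one reaches a zero of `h`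
before leaving the hyperbolic region. -/
theorem exists_right_endpoint {c d e : ℝ} (hc : c < 0)
    (hclosed : IsClosed (connectedComponentIn (hypLevel (binaryQuartic 1 0 c d e)) ![1, 0])) :
    ∃ b > 0, binaryQuartic 1 0 c d e ![1, b] = 0 ∧ ∀ s, 0 ≤ s → s < b →
      0 < binaryQuartic 1 0 c d e ![1, s] ∧ hessDet2 (binaryQuartic 1 0 c d e) ![1, s] < 0 := by
  set h := binaryQuartic 1 0 c d e with hh_def
  have hh : IsBinaryQuartic h := ⟨_, _, _, _, _, rfl⟩
  have hray : Continuous fun t : ℝ => (![1, t] : Fin 2 → ℝ) := by fun_prop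
  have hgc : Continuous fun t : ℝ => h ![1, t] := hh.continuous.comp hray
  have hDc : Continuous fun t : ℝ => hessDet2 h ![1, t] := hh.continuous_hessDet2.comp hray
  set Z : Set ℝ := {t | 0 ≤ t ∧ (h ![1, t] ≤ 0 ∨ 0 ≤ hessDet2 h ![1, t])} with hZ
  have hZclosed : IsClosed Z := by
    refine (isClosed_le continuous_const continuous_id).inter ?_
    exact (isClosed_le hgc continuous_const).union (isClosed_le continuous_const hDc)
  have hZne : Z.Nonempty := by
    by_contra hempty
    refine not_forall_pos_and_hessQuartic_neg (d := d) (e := e) hc fun t ht => ?_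
    have hnot : t ∉ Z := fun h => hempty ⟨t, h⟩
    have h1 : ¬ (h ![1, t] ≤ 0 ∨ 0 ≤ hessDet2 h ![1, t]) := fun h => hnot ⟨ht, h⟩
    push Not at h1
    refine ⟨h1.1, ?_⟩
    have := h1.2
    rw [hh_def, hessDet2_binaryQuartic] at this
    simpa using this
  have hZbdd : BddBelow Z := ⟨0, fun t ht => ht.1⟩
  set b := sInf Z with hb
  have hbZ : b ∈ Z := hZclosed.csInf_mem hZne hZbdd
  have hlt (s : ℝ) (hs0 : 0 ≤ s) (hsb : s < b) : 0 < h ![1, s] ∧ hessDet2 h ![1, s] < 0 := by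
    have h1 : ¬ (h ![1, s] ≤ 0 ∨ 0 ≤ hessDet2 h ![1, s]) :=
      fun h => notMem_of_lt_csInf hsb hZbdd ⟨hs0, h⟩
    push Not at h1
    exact h1
  have h10 : h ![1, 0] = 1 := by simp [hh_def, binaryQuartic]
  have hb0 : 0 < b := by
    refine lt_of_le_of_ne hbZ.1 fun h0 => ?_
    rcases hbZ.2 with h1 | h1
    · rw [← h0, h10] at h1
      linarith
    · rw [← h0, hh_def, hessDet2_binaryQuartic] at h1
      simp [hessQuartic] at h1
      linarith
  have hev : ∀ᶠ s in nhdsWithin b (Set.Iio b), 0 ≤ s ∧ s < b := by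
    filter_upwards [Ico_mem_nhdsLT hb0] with s hs using hs
  have hgb : 0 ≤ h ![1, b] :=
    ge_of_tendsto (hgc.continuousWithinAt (s := Set.Iio b) (x := b))
      (hev.mono fun s hs => (hlt s hs.1 hs.2).1.le)
  refine ⟨b, hb0, ?_, hlt⟩
  by_contra hgb0
  have hgbpos : 0 < h ![1, b] := lt_of_le_of_ne hgb (Ne.symm hgb0)
  have hpre : IsPreconnected ((fun t : ℝ => (![1, t] : Fin 2 → ℝ)) '' Set.Ico 0 b) :=
    isPreconnected_Ico.image _ hray.continuousOn
  have hmem (s : ℝ) (hs : 0 ≤ s ∧ s < b) : h ![1, s] ^ (-(1 / 4) : ℝ) • ![1, s] ∈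
      connectedComponentIn (hypLevel h) ![1, 0] := by
    refine hh.smul_mem_connectedComponentIn hpre ?_ ?_ ⟨0, ⟨le_rfl, hb0⟩, rfl⟩ h10 ⟨s, hs, rfl⟩
    · rintro _ ⟨t, ht, rfl⟩
      exact (hlt t ht.1 ht.2).1
    · rintro _ ⟨t, ht, rfl⟩
      exact (hlt t ht.1 ht.2).2
  have hlim : Filter.Tendsto (fun s : ℝ => h ![1, s] ^ (-(1 / 4) : ℝ) • (![1, s] : Fin 2 → ℝ))
      (nhdsWithin b (Set.Iio b)) (nhds (h ![1, b] ^ (-(1 / 4) : ℝ) • ![1, b])) :=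
    ((hgc.continuousWithinAt.tendsto).rpow_const (Or.inl hgb0)).smul
      hray.continuousWithinAt.tendsto
  have hbmem := hclosed.mem_of_tendsto hlim (hev.mono hmem)
  have hDb := (connectedComponentIn_subset _ _ hbmem).2
  rw [hh.hessDet2_smul] at hDb
  have hDb' : hessDet2 h ![1, b] < 0 := by
    by_contra! hcon
    exact absurd hDb (not_lt.2 (by positivity))
  rcases hbZ.2 with h1 | h1 <;> linarith

theorem isUnit_of_det_ne_zero {A : Matrix (Fin 2) (Fin 2) ℝ} (hA : A.det ≠ 0) : IsUnit A :=
  (Matrix.isUnit_iff_isUnit_det A).2 (isUnit_iff_ne_zero.2 hA)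

theorem IsBinaryQuartic.isClosed_connectedComponentIn_comp {h : (Fin 2 → ℝ) → ℝ}
    (hh : IsBinaryQuartic h) {A : Matrix (Fin 2) (Fin 2) ℝ} (hA : IsUnit A) {p : Fin 2 → ℝ}
    (hp : A *ᵥ p ∈ hypLevel h)
    (hclosed : IsClosed (connectedComponentIn (hypLevel h) (A *ᵥ p))) :
    IsClosed (connectedComponentIn (hypLevel fun v => h (A *ᵥ v)) p) := by
  rw [← hh.image_connectedComponentIn hA hp] at hclosed
  exact (mulVecHomeomorph A hA).isClosed_image.1 hclosed

theorem exists_left_endpoint {c d e : ℝ} (hc : c < 0)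
    (hclosed : IsClosed (connectedComponentIn (hypLevel (binaryQuartic 1 0 c d e)) ![1, 0])) :
    ∃ a > 0, binaryQuartic 1 0 c d e ![1, -a] = 0 ∧ ∀ s, 0 ≤ s → s < a →
      0 < binaryQuartic 1 0 c d e ![1, -s] ∧ hessDet2 (binaryQuartic 1 0 c d e) ![1, -s] < 0 := by
  have hh : IsBinaryQuartic (binaryQuartic 1 0 c d e) := ⟨_, _, _, _, _, rfl⟩
  set R : Matrix (Fin 2) (Fin 2) ℝ := !![1, 0; 0, -1] with hR
  have hRu : IsUnit R := isUnit_of_det_ne_zero (by simp [hR])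
  have hRv (x y : ℝ) : R *ᵥ ![x, y] = ![x, -y] := by
    ext i
    fin_cases i <;> simp [hR]
  have hcomp : (fun v => binaryQuartic 1 0 c d e (R *ᵥ v)) = binaryQuartic 1 0 c (-d) e := by
    rw [binaryQuartic_mulVec]
    simp [hR]
    norm_num
  have hmem : R *ᵥ ![1, 0] ∈ hypLevel (binaryQuartic 1 0 c d e) := by
    rw [hRv]
    refine ⟨by simp [binaryQuartic], ?_⟩
    rw [hessDet2_binaryQuartic]
    simp [hessQuartic]
    linarith
  have hcl := hh.isClosed_connectedComponentIn_comp hRu hmem (by rw [hRv]; simpa using hclosed)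
  rw [hcomp] at hcl
  obtain ⟨a, ha, ha0, hlt⟩ := exists_right_endpoint hc hcl
  refine ⟨a, ha, ?_, fun s hs hsa => ?_⟩
  · rw [← hRv]
    exact (congrFun hcomp _).trans ha0
  · have h1 := hlt s hs hsa
    rw [← hcomp, hh.hessDet2_comp_mulVec] at h1
    simp only [hRv] at h1
    refine ⟨h1.1, ?_⟩
    have h2 := h1.2
    simpa [hR] using h2

theorem exists_cone_normalized {c d e : ℝ} (hc : c < 0)
    (hclosed : IsClosed (connectedComponentIn (hypLevel (binaryQuartic 1 0 c d e)) ![1, 0])) :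
    ∃ A : Matrix (Fin 2) (Fin 2) ℝ, IsUnit A ∧
      (∃ α β γ, (fun v => binaryQuartic 1 0 c d e (A *ᵥ v)) = binaryQuartic 0 α β γ 0) ∧
      ∀ v : Fin 2 → ℝ, 0 < v 0 → 0 < v 1 → 0 < binaryQuartic 1 0 c d e (A *ᵥ v) ∧
        (binaryQuartic 1 0 c d e (A *ᵥ v) = 1 →
          A *ᵥ v ∈ connectedComponentIn (hypLevel (binaryQuartic 1 0 c d e)) ![1, 0]) := by
  obtain ⟨b, hb, hb0, hbs⟩ := exists_right_endpoint hc hclosed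
  obtain ⟨a, ha, ha0, has⟩ := exists_left_endpoint hc hclosed
  set h := binaryQuartic 1 0 c d e with hh_def
  have hh : IsBinaryQuartic h := ⟨_, _, _, _, _, rfl⟩
  have hmid (s : ℝ) (h1 : -a < s) (h2 : s < b) : 0 < h ![1, s] ∧ hessDet2 h ![1, s] < 0 := by
    rcases le_total 0 s with hs | hs
    · exact hbs s hs h2
    · simpa using has (-s) (by linarith) (by linarith)
  set U : Set (Fin 2 → ℝ) := {v | 0 < v 0 ∧ -a * v 0 < v 1 ∧ v 1 < b * v 0} with hU
  have hUconv : Convex ℝ U := by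
    intro v hv w hw s t hs ht hst
    obtain ⟨hv1, hv2, hv3⟩ := hv
    obtain ⟨hw1, hw2, hw3⟩ := hw
    have key {x y : ℝ} (hx : 0 < x) (hy : 0 < y) : 0 < s * x + t * y := by
      rcases hs.eq_or_lt with rfl | hs
      · have : t = 1 := by linarith
        simpa [this] using hy
      · have := mul_pos hs hx
        have := mul_nonneg ht hy.le
        linarith
    refine ⟨?_, ?_, ?_⟩ <;> simp only [Pi.add_apply, Pi.smul_apply, smul_eq_mul]
    · exact key hv1 hw1
    · linarith [key (sub_pos.2 hv2) (sub_pos.2 hw2)]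
    · linarith [key (sub_pos.2 hv3) (sub_pos.2 hw3)]
  have hUray (v) (hv : v ∈ U) : 0 < h v ∧ hessDet2 h v < 0 := by
    obtain ⟨hv1, hv2, hv3⟩ := hv
    have hv : v = v 0 • ![1, v 1 / v 0] := by
      ext i
      fin_cases i
      · simp
      · simp
        field_simp
    have h1 := hmid (v 1 / v 0) (by rwa [lt_div_iff₀ hv1]) (by rwa [div_lt_iff₀ hv1])
    rw [hv, hh.apply_smul, hh.hessDet2_smul]
    have h4 : 0 < v 0 ^ 4 := by positivity
    exact ⟨mul_pos h4 h1.1, mul_neg_of_pos_of_neg h4 h1.2⟩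
  set A : Matrix (Fin 2) (Fin 2) ℝ := !![1, 1; b, -a] with hA
  have hAU (v : Fin 2 → ℝ) (h0 : 0 < v 0) (h1 : 0 < v 1) : A *ᵥ v ∈ U := by
    have hx := mul_pos (add_pos ha hb) h0
    have hy := mul_pos (add_pos ha hb) h1
    refine ⟨?_, ?_, ?_⟩ <;> simp [hA, Matrix.mulVec, dotProduct, Fin.sum_univ_two] <;> linarith
  refine ⟨A, isUnit_of_det_ne_zero ?_, ?_, ?_⟩
  · simp [hA]
    linarith
  · rw [hh_def, binaryQuartic_mulVec]
    simp only [hh_def, binaryQuartic] at hb0 ha0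
    refine ⟨_, _, _, congrArg₂ (fun x y => binaryQuartic x _ _ _ y) ?_ ?_⟩
    · simpa [hA] using hb0
    · simpa [hA] using ha0
  · intro v h0 h1
    refine ⟨(hUray _ (hAU v h0 h1)).1, fun hv => ?_⟩
    have := hh.smul_mem_connectedComponentIn hUconv.isPreconnected (fun v hv => (hUray v hv).1)
      (fun v hv => (hUray v hv).2) (p := ![1, 0]) (by simp [hU, ha, hb])
      (by simp [hh_def, binaryQuartic]) (hAU v h0 h1)
    rwa [hv, Real.one_rpow, one_smul] at this

/-- A closed component is the part of the level set in the open cone spanned by two lines in the zero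
set of `h`; in coordinates adapted to these lines the `x ^ 4` and `y ^ 4` coefficients vanish. -/
theorem exists_cone {h : (Fin 2 → ℝ) → ℝ} (hh : IsBinaryQuartic h) {p : Fin 2 → ℝ}
    (hp : p ∈ hypLevel h) (hclosed : IsClosed (connectedComponentIn (hypLevel h) p)) :
    ∃ A : Matrix (Fin 2) (Fin 2) ℝ, IsUnit A ∧
      (∃ α β γ, (fun v => h (A *ᵥ v)) = binaryQuartic 0 α β γ 0) ∧
      ∀ v : Fin 2 → ℝ, 0 < v 0 → 0 < v 1 → 0 < h (A *ᵥ v) ∧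
        (h (A *ᵥ v) = 1 → A *ᵥ v ∈ connectedComponentIn (hypLevel h) p) := by
  obtain ⟨a, b, c, d, e, hhe⟩ := id hh
  have hp1 : a * p 0 ^ 4 + b * p 0 ^ 3 * p 1 + c * p 0 ^ 2 * p 1 ^ 2 + d * p 0 * p 1 ^ 3 +
      e * p 1 ^ 4 = 1 := by
    have := hp.1
    rwa [hhe] at this
  set B : Matrix (Fin 2) (Fin 2) ℝ :=
    !![p 0, -(b * p 0 ^ 3 + 2 * c * p 0 ^ 2 * p 1 + 3 * d * p 0 * p 1 ^ 2 + 4 * e * p 1 ^ 3);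
      p 1, 4 * a * p 0 ^ 3 + 3 * b * p 0 ^ 2 * p 1 + 2 * c * p 0 * p 1 ^ 2 + d * p 1 ^ 3] with hB
  have hBdet : B.det = 4 := by
    rw [Matrix.det_fin_two]
    simp [hB]
    linear_combination 4 * hp1
  have hBu : IsUnit B := isUnit_of_det_ne_zero (by rw [hBdet]; norm_num)
  have hBp : B *ᵥ ![1, 0] = p := by
    ext i
    fin_cases i <;> simp [hB]
  have hcomp : ∃ c' d' e', (fun v => h (B *ᵥ v)) = binaryQuartic 1 0 c' d' e' := by
    rw [hhe, binaryQuartic_mulVec]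
    refine ⟨_, _, _, congrArg₂ (fun x y => binaryQuartic x y _ _ _) ?_ ?_⟩
    · simpa [hB] using hp1
    · simp [hB]
      ring
  obtain ⟨c', d', e', hcomp⟩ := hcomp
  have hBmem : B *ᵥ ![1, 0] ∈ hypLevel h := by rwa [hBp]
  have hc' : c' < 0 := by
    have := ((hh.mem_hypLevel_comp_iff hBu _).2 hBmem).2
    rw [hcomp, hessDet2_binaryQuartic] at this
    simp [hessQuartic] at this
    linarith
  have hcl := hh.isClosed_connectedComponentIn_comp hBu hBmem (by rwa [hBp])
  have himg := hh.image_connectedComponentIn hBu hBmem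
  rw [hBp, hcomp] at himg
  rw [hcomp] at hcl
  obtain ⟨A, hA, ⟨α, β, γ, hform⟩, hcone⟩ := exists_cone_normalized hc' hcl
  rw [← hcomp] at hform
  simp only [← hcomp] at hcone
  refine ⟨B * A, hBu.mul hA, ⟨α, β, γ, ?_⟩, fun v h0 h1 => ?_⟩
  · simpa only [Matrix.mulVec_mulVec] using hform
  · have h2 := hcone v h0 h1
    rw [← himg, ← hcomp]
    simp only [← Matrix.mulVec_mulVec]
    exact ⟨h2.1, fun h3 => ⟨_, h2.2 h3, rfl⟩⟩

/-- The parameters `(L, K)` of the curves in the classification. -/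
def IsListedParam (L K : ℝ) : Prop :=
  (L = 0 ∧ K ≤ 1 / 4) ∨ (L = 2 * Real.sqrt 2 / (3 * Real.sqrt 3) ∧ K = -(1 / 12)) ∨
    (L = 2 / (3 * Real.sqrt 3) ∧ K = 0)

theorem image_hcurve_eq {h : (Fin 2 → ℝ) → ℝ} (hh : IsBinaryQuartic h) {p : Fin 2 → ℝ}
    {A : Matrix (Fin 2) (Fin 2) ℝ} (hA : IsUnit A)
    (hmem : A *ᵥ ![1, 0] ∈ connectedComponentIn (hypLevel h) p) {L K : ℝ}
    (hcomp : (fun v => h (A *ᵥ v)) = hLK L K) :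
    A.mulVec '' Hcurve L K = connectedComponentIn (hypLevel h) p := by
  rw [hcurve_eq, ← hcomp, hh.image_connectedComponentIn hA (connectedComponentIn_subset _ _ hmem),
    connectedComponentIn_eq hmem]

theorem exists_pos_mul_pow_four_eq_one {P : ℝ} (hP : 0 < P) : ∃ ρ > 0, P * ρ ^ 4 = 1 := by
  refine ⟨P ^ (-(1 / 4) : ℝ), Real.rpow_pos_of_pos hP _, ?_⟩
  rw [← Real.rpow_natCast, ← Real.rpow_mul hP.le]
  norm_num [Real.rpow_neg_one, hP.ne']

theorem exists_hcurve_of_even {h : (Fin 2 → ℝ) → ℝ} (hh : IsBinaryQuartic h) {p : Fin 2 → ℝ}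
    {A : Matrix (Fin 2) (Fin 2) ℝ} (hA : IsUnit A)
    (hmem : A *ᵥ ![1, 0] ∈ connectedComponentIn (hypLevel h) p) {c e : ℝ}
    (hcomp : (fun v => h (A *ᵥ v)) = binaryQuartic 1 0 c 0 e) (hce : 4 * e ≤ c ^ 2) :
    ∃ L K, IsListedParam L K ∧ ∃ A : Matrix (Fin 2) (Fin 2) ℝ, IsUnit A ∧
      A.mulVec '' Hcurve L K = connectedComponentIn (hypLevel h) p := by
  have hc : c < 0 := by
    have := ((hh.mem_hypLevel_comp_iff hA _).2 (connectedComponentIn_subset _ _ hmem)).2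
    rw [hcomp, hessDet2_binaryQuartic] at this
    simp [hessQuartic] at this
    linarith
  obtain ⟨τ, hτ, hτc⟩ : ∃ τ > 0, c * τ ^ 2 = -1 := by
    refine ⟨1 / Real.sqrt (-c), by have := Real.sqrt_pos.2 (neg_pos.2 hc); positivity, ?_⟩
    rw [div_pow, Real.sq_sqrt (by linarith), one_pow, mul_one_div, div_neg, div_self hc.ne]
  set C : Matrix (Fin 2) (Fin 2) ℝ := !![1, 0; 0, τ] with hC
  have hCu : IsUnit C := isUnit_of_det_ne_zero (by simp [hC, hτ.ne'])
  have hCe : C *ᵥ ![1, 0] = ![1, 0] := by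
    ext i
    fin_cases i <;> simp [hC]
  refine ⟨0, e * τ ^ 4, Or.inl ⟨rfl, ?_⟩, A * C, hA.mul hCu,
    image_hcurve_eq hh (hA.mul hCu) ?_ ?_⟩
  · have h1 : c ^ 2 * τ ^ 4 = 1 := by linear_combination (c * τ ^ 2 - 1) * hτc
    have h2 := mul_le_mul_of_nonneg_right hce (by positivity : (0 : ℝ) ≤ τ ^ 4)
    linarith
  · rwa [← Matrix.mulVec_mulVec, hCe]
  · simp only [← Matrix.mulVec_mulVec]
    funext v
    have := congrFun hcomp (C *ᵥ v)
    rw [this]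
    simp [binaryQuartic, hLK, hC, Matrix.mulVec, dotProduct, Fin.sum_univ_two]
    linear_combination v 0 ^ 2 * v 1 ^ 2 * hτc

section Cone

variable {h : (Fin 2 → ℝ) → ℝ} {p : Fin 2 → ℝ} {A : Matrix (Fin 2) (Fin 2) ℝ} {α β γ : ℝ}

theorem exists_hcurve_of_symmetric (hh : IsBinaryQuartic h) (hA : IsUnit A)
    (hform : (fun v => h (A *ᵥ v)) = binaryQuartic 0 α β γ 0)
    (hcone : ∀ v : Fin 2 → ℝ, 0 < v 0 → 0 < v 1 → 0 < h (A *ᵥ v) ∧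
        (h (A *ᵥ v) = 1 → A *ᵥ v ∈ connectedComponentIn (hypLevel h) p))
    {s r : ℝ} (hs : 0 < s) (hr : 0 < r) (hsr : α * s ^ 2 = γ * r ^ 2) :
    ∃ L K, IsListedParam L K ∧ ∃ A : Matrix (Fin 2) (Fin 2) ℝ, IsUnit A ∧
      A.mulVec '' Hcurve L K = connectedComponentIn (hypLevel h) p := by
  have hval (v : Fin 2 → ℝ) : h (A *ᵥ v) = binaryQuartic 0 α β γ 0 v := congrFun hform v
  set m := α * s ^ 2 with hm
  set n := β * s * r with hn
  have hP : 0 < s * r * (2 * m + n) := by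
    have := (hcone ![s, r] hs hr).1
    rw [hval] at this
    simp [binaryQuartic] at this
    have h2 : s * r * (2 * m + n) = α * s ^ 3 * r + β * s ^ 2 * r ^ 2 + γ * s * r ^ 3 := by
      rw [hn]
      linear_combination s * r * hsr + 2 * s * r * hm
    linarith
  obtain ⟨ρ, hρ, hρ4⟩ := exists_pos_mul_pow_four_eq_one hP
  set C : Matrix (Fin 2) (Fin 2) ℝ := !![s * ρ, s; r * ρ, -r] with hC
  have hCu : IsUnit C := isUnit_of_det_ne_zero (by
    have : C.det = -(2 * s * r * ρ) := by
      simp [hC]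
      ring
    rw [this]
    exact neg_ne_zero.2 (by positivity))
  have hcomp : (fun v => h ((A * C) *ᵥ v)) =
      binaryQuartic 1 0 (-(2 * s * r * n * ρ ^ 2)) 0 (s * r * (n - 2 * m)) := by
    funext v
    rw [← Matrix.mulVec_mulVec, hval]
    simp [binaryQuartic, hC, Matrix.mulVec, dotProduct, Fin.sum_univ_two]
    have hm' : α * s ^ 2 - m = 0 := by rw [hm]; ring
    have hγ : γ * r ^ 2 - m = 0 := by rw [← hsr]; ring
    have hn' : β * s * r - n = 0 := by rw [hn]; ring
    linear_combination v 0 ^ 4 * hρ4 +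
      s * r * ((ρ * v 0) ^ 2 - v 1 ^ 2) * ((ρ * v 0 + v 1) ^ 2 * hm' +
        ((ρ * v 0) ^ 2 - v 1 ^ 2) * hn' + (ρ * v 0 - v 1) ^ 2 * hγ)
  refine exists_hcurve_of_even hh (hA.mul hCu) ?_ hcomp ?_
  · have h1 : h ((A * C) *ᵥ ![1, 0]) = 1 := by
      have := congrFun hcomp ![1, 0]
      simpa [binaryQuartic] using this
    rw [← Matrix.mulVec_mulVec] at h1 ⊢
    refine (hcone _ ?_ ?_).2 h1 <;> simp [hC] <;> positivity
  · have hsr0 : 0 < s * r := mul_pos hs hr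
    have hmn : 0 < 2 * m + n := pos_of_mul_pos_right hP hsr0.le
    have hρ' : ρ ^ 4 = 1 / (s * r * (2 * m + n)) := by
      field_simp
      linear_combination hρ4
    have h2 : (-(2 * s * r * n * ρ ^ 2)) ^ 2 = 4 * (s * r) * n ^ 2 / (2 * m + n) := by
      have : (-(2 * s * r * n * ρ ^ 2)) ^ 2 = 4 * (s * r) ^ 2 * n ^ 2 * ρ ^ 4 := by ring
      rw [this, hρ']
      field_simp
    rw [h2, le_div_iff₀ hmn]
    nlinarith [mul_nonneg hsr0.le (sq_nonneg m)]

theorem nonneg_of_cone (hform : (fun v => h (A *ᵥ v)) = binaryQuartic 0 α β γ 0)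
    (hcone : ∀ v : Fin 2 → ℝ, 0 < v 0 → 0 < v 1 → 0 < h (A *ᵥ v)) :
    0 ≤ α ∧ 0 ≤ γ ∧ (α = 0 → 0 ≤ β) := by
  have hval (x y : ℝ) (hx : 0 < x) (hy : 0 < y) : 0 < α * x ^ 2 + β * x * y + γ * y ^ 2 := by
    have h1 := hcone ![x, y] hx hy
    have h2 := congrFun hform ![x, y]
    rw [h2] at h1
    simp [binaryQuartic] at h1
    have h3 : α * x ^ 3 * y + β * x ^ 2 * y ^ 2 + γ * x * y ^ 3 =
      x * y * (α * x ^ 2 + β * x * y + γ * y ^ 2) := by ring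
    rw [h3] at h1
    exact pos_of_mul_pos_right h1 (by positivity)
  have hlim {f : ℝ → ℝ} (hf : Continuous f) (hpos : ∀ t, 0 < t → 0 < f t) : 0 ≤ f 0 := by
    refine ge_of_tendsto (hf.continuousWithinAt (s := Set.Ioi 0) (x := 0)) ?_
    filter_upwards [self_mem_nhdsWithin] with t ht using (hpos t ht).le
  refine ⟨?_, ?_, fun hα => ?_⟩
  · have := hlim (f := fun t => α * 1 ^ 2 + β * 1 * t + γ * t ^ 2) (by fun_prop)
      fun t ht => hval 1 t one_pos ht
    simpa using this
  · have := hlim (f := fun t => α * t ^ 2 + β * t * 1 + γ * 1 ^ 2) (by fun_prop)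
      fun t ht => hval t 1 ht one_pos
    simpa using this
  · have := hlim (f := fun t => β + γ * t) (by fun_prop) fun t ht => by
      have := hval 1 t one_pos ht
      rw [hα] at this
      have h1 : 0 * 1 ^ 2 + β * 1 * t + γ * t ^ 2 = t * (β + γ * t) := by ring
      rw [h1] at this
      exact pos_of_mul_pos_right this ht.le
    simpa using this

theorem two_mul_sqrt_two_div : 2 * Real.sqrt 2 / (3 * Real.sqrt 3) = 2 / 9 * Real.sqrt 6 := by
  have h3 : Real.sqrt 3 ^ 2 = 3 := Real.sq_sqrt (by norm_num)
  have h6 : Real.sqrt 6 = Real.sqrt 2 * Real.sqrt 3 := by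
    rw [← Real.sqrt_mul (by norm_num)]
    norm_num
  have h30 : Real.sqrt 3 ≠ 0 := by positivity
  rw [h6, div_eq_iff (by positivity)]
  linear_combination -(2 / 3) * Real.sqrt 2 * h3

theorem two_div_sqrt_three : 2 / (3 * Real.sqrt 3) = 2 / 9 * Real.sqrt 3 := by
  have h3 : Real.sqrt 3 ^ 2 = 3 := Real.sq_sqrt (by norm_num)
  rw [div_eq_iff (by positivity)]
  linear_combination -(2 / 3) * h3

theorem exists_hcurve_of_eq_zero (hh : IsBinaryQuartic h) (hA : IsUnit A)
    (hform : (fun v => h (A *ᵥ v)) = binaryQuartic 0 0 β γ 0)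
    (hcone : ∀ v : Fin 2 → ℝ, 0 < v 0 → 0 < v 1 →
        (h (A *ᵥ v) = 1 → A *ᵥ v ∈ connectedComponentIn (hypLevel h) p))
    (hβ : 0 ≤ β) (hγ : 0 < γ) :
    ∃ L K, IsListedParam L K ∧ ∃ A : Matrix (Fin 2) (Fin 2) ℝ, IsUnit A ∧
      A.mulVec '' Hcurve L K = connectedComponentIn (hypLevel h) p := by
  have hval (v : Fin 2 → ℝ) : h (A *ᵥ v) = binaryQuartic 0 0 β γ 0 v := congrFun hform v
  have key {C : Matrix (Fin 2) (Fin 2) ℝ} {L K : ℝ} (hLK : IsListedParam L K) (hC : C.det ≠ 0)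
      (h0 : 0 < C 0 0) (h1 : 0 < C 1 0)
      (hcomp : (fun v => binaryQuartic 0 0 β γ 0 (C *ᵥ v)) = _root_.hLK L K) :
      ∃ L K, IsListedParam L K ∧ ∃ A : Matrix (Fin 2) (Fin 2) ℝ, IsUnit A ∧
        A.mulVec '' Hcurve L K = connectedComponentIn (hypLevel h) p := by
    have hCu := hA.mul (isUnit_of_det_ne_zero hC)
    have hcomp' : (fun v => h ((A * C) *ᵥ v)) = _root_.hLK L K := by
      rw [← hcomp]
      funext v
      rw [← Matrix.mulVec_mulVec, hval]
    refine ⟨L, K, hLK, A * C, hCu, image_hcurve_eq hh hCu ?_ hcomp'⟩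
    have h2 : h ((A * C) *ᵥ ![1, 0]) = 1 := by
      have := congrFun hcomp' ![1, 0]
      simpa [_root_.hLK] using this
    rw [← Matrix.mulVec_mulVec] at h2 ⊢
    refine hcone _ ?_ ?_ h2 <;> simpa
  rcases hβ.eq_or_lt with rfl | hβ
  · have h6 : Real.sqrt 6 ^ 2 = 6 := Real.sq_sqrt (by norm_num)
    have hw : 0 < Real.sqrt 6 := by positivity
    set w := Real.sqrt 6 with hw_def
    obtain ⟨s, hs, hsγ⟩ : ∃ s > 0, γ * s = 1 / 12 :=
      ⟨1 / (12 * γ), by positivity, by field_simp⟩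
    refine key (C := !![s * (w / 3), s; w, -1]) (Or.inr (Or.inl ⟨rfl, rfl⟩)) ?_ ?_ ?_ ?_
    · have : (!![s * (w / 3), s; w, -1] : Matrix (Fin 2) (Fin 2) ℝ).det = -(4 / 3 * s * w) := by
        simp
        ring
      rw [this]
      exact neg_ne_zero.2 (by positivity)
    · simp; positivity
    · simpa
    · rw [two_mul_sqrt_two_div, ← hw_def]
      funext v
      simp [binaryQuartic, hLK, Matrix.mulVec, dotProduct, Fin.sum_univ_two]
      linear_combination (w * v 0 - v 1) ^ 3 * (w / 3 * v 0 + v 1) * hsγ +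
        (v 0 ^ 4 * (w ^ 2 + 6) / 36 - v 0 ^ 2 * v 1 ^ 2 / 6) * h6
  · have h3 : Real.sqrt 3 ^ 2 = 3 := Real.sq_sqrt (by norm_num)
    have hw : 0 < Real.sqrt 3 := by positivity
    set w := Real.sqrt 3 with hw_def
    obtain ⟨κ, hκ, hκ4⟩ := exists_pos_mul_pow_four_eq_one
      (by positivity : 0 < 4 / (27 * β * γ ^ 2))
    obtain ⟨s, r, hs, hr, hsβ, hrγ, hsr⟩ : ∃ s r, 0 < s ∧ 0 < r ∧ β * s = κ / 3 ∧
        γ * r = 2 * κ / 3 ∧ κ * s * r ^ 2 = 1 := by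
      refine ⟨κ / (3 * β), 2 * κ / (3 * γ), by positivity, by positivity, by field_simp,
        by field_simp, ?_⟩
      rw [← hκ4]
      field_simp
      norm_num
    refine key (C := !![s, s * (2 * (w / 3)); r, -(r * (w / 3))])
      (Or.inr (Or.inr ⟨rfl, rfl⟩)) ?_ ?_ ?_ ?_
    · have : (!![s, s * (2 * (w / 3)); r, -(r * (w / 3))] : Matrix (Fin 2) (Fin 2) ℝ).det =
          -(s * r * w) := by
        simp
        ring
      rw [this]
      exact neg_ne_zero.2 (by positivity)
    · simpa
    · simpa
    · rw [two_div_sqrt_three, ← hw_def]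
      funext v
      simp [binaryQuartic, hLK, Matrix.mulVec, dotProduct, Fin.sum_univ_two]
      linear_combination s * r ^ 2 * (v 0 + 2 * (w / 3) * v 1) * (v 0 - w / 3 * v 1) ^ 2 *
          ((v 0 + 2 * (w / 3) * v 1) * hsβ + (v 0 - w / 3 * v 1) * hrγ) +
        v 0 * (v 0 + 2 * (w / 3) * v 1) * (v 0 - w / 3 * v 1) ^ 2 * hsr +
        (2 * w / 27 * v 0 * v 1 ^ 3 - v 0 ^ 2 * v 1 ^ 2 / 3) * h3

theorem exists_hcurve_of_cone (hh : IsBinaryQuartic h) (hA : IsUnit A)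
    (hform : (fun v => h (A *ᵥ v)) = binaryQuartic 0 α β γ 0)
    (hcone : ∀ v : Fin 2 → ℝ, 0 < v 0 → 0 < v 1 → 0 < h (A *ᵥ v) ∧
        (h (A *ᵥ v) = 1 → A *ᵥ v ∈ connectedComponentIn (hypLevel h) p)) :
    ∃ L K, IsListedParam L K ∧ ∃ A : Matrix (Fin 2) (Fin 2) ℝ, IsUnit A ∧
      A.mulVec '' Hcurve L K = connectedComponentIn (hypLevel h) p := by
  obtain ⟨hα, hγ, hβ⟩ := nonneg_of_cone hform fun v h0 h1 => (hcone v h0 h1).1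
  set R : Matrix (Fin 2) (Fin 2) ℝ := !![0, 1; 1, 0] with hR
  have hRu : IsUnit R := isUnit_of_det_ne_zero (by simp [hR])
  have hform' : (fun v => h ((A * R) *ᵥ v)) = binaryQuartic 0 γ β α 0 := by
    funext v
    rw [← Matrix.mulVec_mulVec]
    refine (congrFun hform _).trans ?_
    simp [binaryQuartic, hR, Matrix.mulVec, dotProduct, Fin.sum_univ_two]
    ring
  have hcone' (v : Fin 2 → ℝ) (h0 : 0 < v 0) (h1 : 0 < v 1) : 0 < h ((A * R) *ᵥ v) ∧
      (h ((A * R) *ᵥ v) = 1 → (A * R) *ᵥ v ∈ connectedComponentIn (hypLevel h) p) := by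
    rw [← Matrix.mulVec_mulVec]
    exact hcone _ (by simpa [hR, Matrix.mulVec, dotProduct] using h1)
      (by simpa [hR, Matrix.mulVec, dotProduct] using h0)
  rcases hα.eq_or_lt with rfl | hα <;> rcases hγ.eq_or_lt with rfl | hγ
  · exact exists_hcurve_of_symmetric hh hA hform hcone one_pos one_pos rfl
  · exact exists_hcurve_of_eq_zero hh hA hform (fun v h0 h1 => (hcone v h0 h1).2) (hβ rfl) hγ
  · exact exists_hcurve_of_eq_zero hh (hA.mul hRu) hform' (fun v h0 h1 => (hcone' v h0 h1).2)
      ((nonneg_of_cone hform' fun v h0 h1 => (hcone' v h0 h1).1).2.2 rfl) hα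
  · refine exists_hcurve_of_symmetric hh hA hform hcone (Real.sqrt_pos.2 hγ)
      (Real.sqrt_pos.2 hα) ?_
    rw [Real.sq_sqrt hγ.le, Real.sq_sqrt hα.le, mul_comm]

end Cone

theorem binaryQuartic_coeff_eq {a b c d e a' b' c' d' e' : ℝ}
    (heq : ∀ᶠ t in nhds (0 : ℝ),
      binaryQuartic a b c d e ![1, t] = binaryQuartic a' b' c' d' e' ![1, t]) :
    a = a' ∧ b = b' ∧ c = c' ∧ d = d' ∧ e = e' := by
  let q : ℝ → ℝ → ℝ → ℝ → ℝ → Polynomial ℝ := fun a b c d e =>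
    Polynomial.C a + Polynomial.C b * Polynomial.X + Polynomial.C c * Polynomial.X ^ 2 +
      Polynomial.C d * Polynomial.X ^ 3 + Polynomial.C e * Polynomial.X ^ 4
  have hq : q a b c d e = q a' b' c' d' e' := by
    refine Polynomial.eq_of_infinite_eval_eq _ _ (infinite_of_mem_nhds (0 : ℝ) ?_)
    filter_upwards [heq] with t ht
    simpa [q, binaryQuartic] using ht
  have hcoeff (n : ℕ) := congrArg (fun P => Polynomial.coeff P n) hq
  have h0 := hcoeff 0
  have h1 := hcoeff 1
  have h2 := hcoeff 2
  have h3 := hcoeff 3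
  have h4 := hcoeff 4
  simp [q, Polynomial.coeff_X_pow, Polynomial.coeff_X, Polynomial.coeff_C] at h0 h1 h2 h3 h4
  exact ⟨h0, h1, h2, h3, h4⟩

theorem comp_eq_of_mapsTo {h k : (Fin 2 → ℝ) → ℝ} (hh : IsBinaryQuartic h)
    (hk : IsBinaryQuartic k) (hmem : ![1, 0] ∈ hypLevel h)
    (hmaps : ∀ v ∈ connectedComponentIn (hypLevel h) ![1, 0], k v = 1) : k = h := by
  have hray : Continuous fun t : ℝ => (![1, t] : Fin 2 → ℝ) := by fun_prop
  have hev : ∀ᶠ t in nhds (0 : ℝ), 0 < h ![1, t] ∧ hessDet2 h ![1, t] < 0 := by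
    refine ((hh.continuous.comp hray).continuousAt.eventually_const_lt ?_).and
      ((hh.continuous_hessDet2.comp hray).continuousAt.eventually_lt_const ?_)
    · simp [hmem.1]
    · exact hmem.2
  obtain ⟨ε, hε, hball⟩ := Metric.eventually_nhds_iff_ball.1 hev
  have hpre : IsPreconnected ((fun t : ℝ => (![1, t] : Fin 2 → ℝ)) '' Metric.ball 0 ε) :=
    (convex_ball _ _).isPreconnected.image _ hray.continuousOn
  have hval : ∀ᶠ t in nhds (0 : ℝ), k ![1, t] = h ![1, t] := by
    filter_upwards [Metric.ball_mem_nhds (0 : ℝ) hε] with t ht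
    have h1 := hh.smul_mem_connectedComponentIn hpre
      (by rintro _ ⟨t, ht, rfl⟩; exact (hball t ht).1)
      (by rintro _ ⟨t, ht, rfl⟩; exact (hball t ht).2)
      ⟨0, Metric.mem_ball_self hε, rfl⟩ hmem.1 ⟨t, ht, rfl⟩
    have h2 := hmaps _ h1
    have h3 := (connectedComponentIn_subset _ _ h1).1
    rw [hk.apply_smul] at h2
    rw [hh.apply_smul] at h3
    exact mul_left_cancel₀ (left_ne_zero_of_mul (h2.trans_ne one_ne_zero)) (h2.trans h3.symm)
  obtain ⟨a, b, c, d, e, rfl⟩ := hh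
  obtain ⟨a', b', c', d', e', rfl⟩ := hk
  obtain ⟨rfl, rfl, rfl, rfl, rfl⟩ := binaryQuartic_coeff_eq hval
  rfl

/-- `12` times the quadratic invariant of a binary quartic form. -/
def quarticInvI (a b c d e : ℝ) : ℝ := 12 * a * e - 3 * b * d + c ^ 2

/-- `432` times the cubic invariant of a binary quartic form. -/
def quarticInvJ (a b c d e : ℝ) : ℝ :=
  72 * a * c * e + 9 * b * c * d - 27 * a * d ^ 2 - 27 * e * b ^ 2 - 2 * c ^ 3

theorem quarticInv_comp {a b c d e a' b' c' d' e' : ℝ} {A : Matrix (Fin 2) (Fin 2) ℝ}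
    (hcomp : (fun v => binaryQuartic a b c d e (A *ᵥ v)) = binaryQuartic a' b' c' d' e') :
    quarticInvI a' b' c' d' e' = A.det ^ 4 * quarticInvI a b c d e ∧
      quarticInvJ a' b' c' d' e' = A.det ^ 6 * quarticInvJ a b c d e := by
  rw [binaryQuartic_mulVec] at hcomp
  obtain ⟨rfl, rfl, rfl, rfl, rfl⟩ :=
    binaryQuartic_coeff_eq (Filter.Eventually.of_forall fun t => congrFun hcomp ![1, t])
  rw [Matrix.det_fin_two]
  constructor
  · simp only [quarticInvI]
    ring
  · simp only [quarticInvJ]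
    ring

theorem mem_hypLevel_hLK (L K : ℝ) : ![1, 0] ∈ hypLevel (hLK L K) := by
  refine ⟨by simp [hLK], ?_⟩
  rw [hLK_eq_binaryQuartic, hessDet2_binaryQuartic]
  simp [hessQuartic]

theorem exists_comp_hLK_of_image_eq {L K L' K' : ℝ} {A A' : Matrix (Fin 2) (Fin 2) ℝ}
    (hA : IsUnit A) (hA' : IsUnit A')
    (himg : A.mulVec '' Hcurve L K = A'.mulVec '' Hcurve L' K') :
    ∃ C : Matrix (Fin 2) (Fin 2) ℝ, C.det ≠ 0 ∧ (fun v => hLK L' K' (C *ᵥ v)) = hLK L K := by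
  refine ⟨A'⁻¹ * A, ?_, ?_⟩
  · exact ((Matrix.isUnit_iff_isUnit_det _).1
      ((Matrix.isUnit_nonsing_inv_iff.2 hA').mul hA)).ne_zero
  · refine comp_eq_of_mapsTo (isBinaryQuartic_hLK L K)
      ((isBinaryQuartic_hLK L' K').comp_mulVec _) (mem_hypLevel_hLK L K) fun v hv => ?_
    obtain ⟨w, hw, hwv⟩ : A *ᵥ v ∈ A'.mulVec '' Hcurve L' K' := himg ▸ ⟨v, hv, rfl⟩
    rw [← Matrix.mulVec_mulVec, ← hwv, inv_mulVec_mulVec hA']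
    exact (connectedComponentIn_subset _ _ hw).1

theorem exists_scale_of_image_eq {L K L' K' : ℝ} {A A' : Matrix (Fin 2) (Fin 2) ℝ}
    (hA : IsUnit A) (hA' : IsUnit A')
    (himg : A.mulVec '' Hcurve L K = A'.mulVec '' Hcurve L' K') :
    ∃ δ > 0, 12 * K + 1 = δ ^ 2 * (12 * K' + 1) ∧
      2 - 72 * K - 27 * L ^ 2 = δ ^ 3 * (2 - 72 * K' - 27 * L' ^ 2) := by
  obtain ⟨C, hC, hcomp⟩ := exists_comp_hLK_of_image_eq hA hA' himg
  rw [hLK_eq_binaryQuartic, hLK_eq_binaryQuartic] at hcomp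
  obtain ⟨hI, hJ⟩ := quarticInv_comp hcomp
  refine ⟨C.det ^ 2, by positivity, ?_, ?_⟩
  · simp only [quarticInvI] at hI
    linear_combination hI
  · simp only [quarticInvJ] at hJ
    linear_combination hJ

theorem eq_of_image_even {K K' : ℝ} (hK : K ≤ 1 / 4) (hK' : K' ≤ 1 / 4)
    {A A' : Matrix (Fin 2) (Fin 2) ℝ} (hA : IsUnit A) (hA' : IsUnit A')
    (himg : A.mulVec '' Hcurve 0 K = A'.mulVec '' Hcurve 0 K') : K = K' := by
  obtain ⟨δ, hδ, hI, hJ⟩ := exists_scale_of_image_eq hA hA' himg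
  have h1 : (1 - δ) * (4 * (1 + δ + δ ^ 2) - 3 * δ ^ 2 * (12 * K' + 1)) = 0 := by
    linear_combination 3 * hI + 1 / 2 * hJ
  rcases mul_eq_zero.1 h1 with h2 | h2
  · have : δ = 1 := by linarith
    subst this
    linarith
  · have h3 : 0 ≤ (2 * δ + 1) * (δ - 1) := by
      have := mul_nonneg (sq_nonneg δ) (sub_nonneg.2 hK')
      nlinarith
    have h4 : (δ + 2) * (δ - 1) ≤ 0 := by nlinarith
    have h5 : δ = 1 := by
      have := nonneg_of_mul_nonneg_right h3 (by positivity)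
      have := nonpos_of_mul_nonpos_right h4 (by positivity)
      linarith
    subst h5
    linarith

theorem sq_two_mul_sqrt_two_div : (2 * Real.sqrt 2 / (3 * Real.sqrt 3)) ^ 2 = 8 / 27 := by
  rw [two_mul_sqrt_two_div, mul_pow, Real.sq_sqrt (by norm_num)]
  norm_num

theorem sq_two_div_sqrt_three : (2 / (3 * Real.sqrt 3)) ^ 2 = 4 / 27 := by
  rw [two_div_sqrt_three, mul_pow, Real.sq_sqrt (by norm_num)]
  norm_num

theorem image_even_ne_triple {K : ℝ} {A A' : Matrix (Fin 2) (Fin 2) ℝ} (hA : IsUnit A)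
    (hA' : IsUnit A') : A.mulVec '' Hcurve 0 K ≠
      A'.mulVec '' Hcurve (2 * Real.sqrt 2 / (3 * Real.sqrt 3)) (-(1 / 12)) := by
  intro himg
  obtain ⟨δ, hδ, hI, hJ⟩ := exists_scale_of_image_eq hA hA' himg
  rw [sq_two_mul_sqrt_two_div] at hJ
  norm_num at hI hJ
  linarith

theorem image_double_ne_triple {A A' : Matrix (Fin 2) (Fin 2) ℝ} (hA : IsUnit A)
    (hA' : IsUnit A') : A.mulVec '' Hcurve (2 / (3 * Real.sqrt 3)) 0 ≠
      A'.mulVec '' Hcurve (2 * Real.sqrt 2 / (3 * Real.sqrt 3)) (-(1 / 12)) := by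
  intro himg
  obtain ⟨δ, hδ, hI, hJ⟩ := exists_scale_of_image_eq hA hA' himg
  norm_num at hI

theorem image_double_ne_even {K : ℝ} (hK : K ≤ 1 / 4) {A A' : Matrix (Fin 2) (Fin 2) ℝ}
    (hA : IsUnit A) (hA' : IsUnit A') :
    A.mulVec '' Hcurve (2 / (3 * Real.sqrt 3)) 0 ≠ A'.mulVec '' Hcurve 0 K := by
  intro himg
  have hK4 : K = 1 / 4 := by
    obtain ⟨δ, hδ, hI, hJ⟩ := exists_scale_of_image_eq hA' hA himg.symm
    rw [sq_two_div_sqrt_three] at hJ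
    have h1 : (δ + 1) * (δ - 2) ^ 2 = 0 := by
      linear_combination 1 / 2 * hJ + 3 * hI
    have h2 : δ = 2 := by
      rcases mul_eq_zero.1 h1 with h | h
      · linarith
      · have := pow_eq_zero_iff (two_ne_zero) |>.1 h
        linarith
    subst h2
    linarith
  obtain ⟨C, hC, hcomp⟩ := exists_comp_hLK_of_image_eq hA hA' himg
  have h1 := congrFun hcomp ![-(1 / 2), 1]
  have h2 (v : Fin 2 → ℝ) : 0 ≤ hLK 0 K v := by
    have : hLK 0 K v = (v 0 ^ 2 - v 1 ^ 2 / 2) ^ 2 := by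
      rw [hLK, hK4]
      ring
    rw [this]
    positivity
  have h3 : 0 < 2 / (3 * Real.sqrt 3) := by positivity
  have h4 := (h2 _).trans_eq h1
  simp only [hLK, Matrix.cons_val_zero, Matrix.cons_val_one] at h4
  linarith

theorem eq_of_image_eq {L K L' K' : ℝ} (h : IsListedParam L K) (h' : IsListedParam L' K')
    {A A' : Matrix (Fin 2) (Fin 2) ℝ} (hA : IsUnit A) (hA' : IsUnit A')
    (himg : A.mulVec '' Hcurve L K = A'.mulVec '' Hcurve L' K') : L = L' ∧ K = K' := by
  rcases h with ⟨rfl, hK⟩ | ⟨rfl, rfl⟩ | ⟨rfl, rfl⟩ <;>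
    rcases h' with ⟨rfl, hK'⟩ | ⟨rfl, rfl⟩ | ⟨rfl, rfl⟩
  · exact ⟨rfl, eq_of_image_even hK hK' hA hA' himg⟩
  · exact absurd himg (image_even_ne_triple hA hA')
  · exact absurd himg.symm (image_double_ne_even hK hA' hA)
  · exact absurd himg.symm (image_even_ne_triple hA' hA)
  · exact ⟨rfl, rfl⟩
  · exact absurd himg.symm (image_double_ne_triple hA' hA)
  · exact absurd himg (image_double_ne_even hK' hA hA')
  · exact absurd himg (image_double_ne_triple hA hA')
  · exact ⟨rfl, rfl⟩

theorem listed_iff_exists_param (M : Set (Fin 2 → ℝ)) :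
    (M = Hcurve 0 (1/4) ∨
      M = Hcurve (2 * Real.sqrt 2 / (3 * Real.sqrt 3)) (-(1/12)) ∨
      M = Hcurve (2 / (3 * Real.sqrt 3)) 0 ∨
      (∃ K : ℝ, K < 1/4 ∧ M = Hcurve 0 K)) ↔
    ∃ L K, IsListedParam L K ∧ M = Hcurve L K := by
  constructor
  · rintro (rfl | rfl | rfl | ⟨K, hK, rfl⟩)
    · exact ⟨_, _, Or.inl ⟨rfl, le_rfl⟩, rfl⟩
    · exact ⟨_, _, Or.inr (Or.inl ⟨rfl, rfl⟩), rfl⟩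
    · exact ⟨_, _, Or.inr (Or.inr ⟨rfl, rfl⟩), rfl⟩
    · exact ⟨_, _, Or.inl ⟨rfl, hK.le⟩, rfl⟩
  · rintro ⟨L, K, ⟨rfl, hK⟩ | ⟨rfl, rfl⟩ | ⟨rfl, rfl⟩, rfl⟩
    · rcases hK.eq_or_lt with rfl | hK
      · exact Or.inl rfl
      · exact Or.inr (Or.inr (Or.inr ⟨K, hK, rfl⟩))
    · exact Or.inr (Or.inl rfl)
    · exact Or.inr (Or.inr (Or.inl rfl))

/-- **Classification of closed connected quartic GPSR curves.**
If the connected component `H` (through a hyperbolic point `p₀` of a homogeneous quartic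
polynomial `h` with `h p₀ = 1`) of the hyperbolic level set is closed, then there is exactly
one curve `M` from the list a)–d) of Theorem 3.1 that is mapped onto `H` by some
linear transformation `A ∈ GL(2,ℝ)`. -/
theorem closed_quartic_GPSR_curve_classification
    (h : (Fin 2 → ℝ) → ℝ)
    (hpoly : ∃ P : MvPolynomial (Fin 2) ℝ, P.IsHomogeneous 4 ∧
      h = fun v => MvPolynomial.eval v P)
    (p₀ : Fin 2 → ℝ) (hp₀1 : h p₀ = 1) (hp₀hyp : hessDet2 h p₀ < 0)
    (H : Set (Fin 2 → ℝ))
    (hH : H = connectedComponentIn {p | h p = 1 ∧ hessDet2 h p < 0} p₀)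
    (hclosed : IsClosed H) :
    ∃! M : Set (Fin 2 → ℝ),
      (M = Hcurve 0 (1/4) ∨
        M = Hcurve (2 * Real.sqrt 2 / (3 * Real.sqrt 3)) (-(1/12)) ∨
        M = Hcurve (2 / (3 * Real.sqrt 3)) 0 ∨
        (∃ K : ℝ, K < 1/4 ∧ M = Hcurve 0 K)) ∧
      ∃ A : Matrix (Fin 2) (Fin 2) ℝ, IsUnit A ∧ A.mulVec '' M = H := by
  have hh : IsBinaryQuartic h := by
    obtain ⟨P, hP, rfl⟩ := hpoly
    exact exists_eq_binaryQuartic hP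
  change H = connectedComponentIn (hypLevel h) p₀ at hH
  subst hH
  obtain ⟨B, hB, ⟨α, β, γ, hform⟩, hcone⟩ := exists_cone hh ⟨hp₀1, hp₀hyp⟩ hclosed
  obtain ⟨L, K, hLK, A, hA, himg⟩ := exists_hcurve_of_cone hh hB hform hcone
  refine ⟨Hcurve L K, ⟨(listed_iff_exists_param _).2 ⟨L, K, hLK, rfl⟩, A, hA, himg⟩, ?_⟩
  rintro M ⟨hM, A', hA', himg'⟩
  obtain ⟨L', K', hLK', rfl⟩ := (listed_iff_exists_param M).1 hM
  obtain ⟨rfl, rfl⟩ := eq_of_image_eq hLK hLK' hA hA' (himg.trans himg'.symm)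
  rfl
end
end

section
/- Characterization of closedness: define u : [−1/12, 1/4] → ℝ by u(K) = (√2/(3√3))·√(1 − 36K + √((1+12K)³)) and w : (−∞, −1/12) → ℝ by w(K) = √(6 − 216K)/9. For all real numbers L, K, the curve H_{L,K} is closed as a subset of ℝ² if and only if either (−1/12 ≤ K ≤ 1/4 and |L| ≤ u(K)) or (K < −1/12 and |L| < w(K)). -/
/-!
Common definitions: the quartic polynomial `hLK L K (x,y) = x⁴ − x²y² + L·x·y³ + K·y⁴` on ℝ²,
the Hessian determinant of a function on ℝ², and the curve `Hcurve L K = H_{L,K}`,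
the connected component containing (1,0) of the hyperbolic points on the level set {h = 1}.
-/

noncomputable section
open Matrix

/-- The restriction of `hLK L K` to the affine line `x = 1`. -/
def quartic (L K t : ℝ) : ℝ := 1 - t ^ 2 + L * t ^ 3 + K * t ^ 4

/-- Minus one third of the Hessian determinant of `hLK L K` at `(1, t)`. -/
def negHess (L K t : ℝ) : ℝ :=
  8 - 24 * L * t + (4 - 48 * K) * t ^ 2 - 4 * L * t ^ 3 + (8 * K + 3 * L ^ 2) * t ^ 4

/-- `hLK L K` is positive and hyperbolic in an open cone around `(1,0)` bounded by zeros. -/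
def HyperbolicUpToZeros (L K : ℝ) : Prop :=
  ∃ a b : ℝ, a < 0 ∧ 0 < b ∧ quartic L K a = 0 ∧ quartic L K b = 0 ∧
    ∀ t ∈ Set.Ioo a b, 0 < quartic L K t ∧ 0 < negHess L K t

/-- The resolvent cubic of `quartic L K` has a root on the branch below its inflection point. -/
def LowResolventRoot (L K : ℝ) : Prop :=
  ∃ z : ℝ, 0 ≤ z ∧ z * ((z - 1) ^ 2 - 4 * K) = L ^ 2 ∧ 0 ≤ 3 * z ^ 2 - 4 * z + 1 - 4 * K ∧
    z ≤ 2 / 3 ∧ (z = 2 / 3 → K = -(1 / 12))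

theorem quartic_continuous (L K : ℝ) : Continuous (quartic L K) := by
  unfold quartic; fun_prop

theorem negHess_continuous (L K : ℝ) : Continuous (negHess L K) := by
  unfold negHess; fun_prop

section Algebra

variable {σ c p : ℝ}

theorem quartic_eq_mul (h : c + p = σ ^ 2 - 1) (t : ℝ) :
    quartic (σ * (p - c)) (p * c) t =
      (1 - σ * t + p * t ^ 2) * (1 + σ * t + c * t ^ 2) := by
  obtain rfl : c = σ ^ 2 - 1 - p := by linarith
  unfold quartic; ring

theorem negHess_eq (h : c + p = σ ^ 2 - 1) (t : ℝ) :
    negHess (σ * (p - c)) (p * c) t =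
      3 * (2 * σ + 2 * (c - p) * t - σ * (c + p) * t ^ 2) ^ 2 +
        4 * (2 - 3 * σ ^ 2) * quartic (σ * (p - c)) (p * c) t := by
  obtain rfl : c = σ ^ 2 - 1 - p := by linarith
  unfold quartic negHess; ring

/-- The second factor dominates a multiple of the first one. -/
theorem mul_le_second_factor (h : c + p = σ ^ 2 - 1) (hp : p < 0) (hpc : p ≤ c)
    (hz : σ ^ 2 ≤ 2 / 3) (hR : 0 ≤ 3 * (σ ^ 2) ^ 2 - 4 * σ ^ 2 + 1 - 4 * (p * c)) (t : ℝ) :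
    (2 - 3 * σ ^ 2) * (1 - σ * t + p * t ^ 2) ≤
      (σ ^ 2 - 4 * p) * (1 + σ * t + c * t ^ 2) := by
  have hc : c = σ ^ 2 - 1 - p := by linarith
  have h0 : 0 ≤ 2 + 4 * c := by nlinarith [sq_nonneg σ]
  rcases h0.eq_or_lt with h0 | h0
  · have hσ : σ ^ 2 = 0 := by nlinarith [sq_nonneg σ]
    have hσ' : σ = 0 := by simpa using hσ
    subst hσ'
    have : p = -1 / 2 := by linarith
    have : c = -1 / 2 := by linarith
    subst_vars
    nlinarith
  · have key : 0 ≤ (2 + 4 * c) * ((σ ^ 2 - 4 * p) * (1 + σ * t + c * t ^ 2) -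
        (2 - 3 * σ ^ 2) * (1 - σ * t + p * t ^ 2)) := by
      have e : (2 + 4 * c) * ((σ ^ 2 - 4 * p) * (1 + σ * t + c * t ^ 2) -
          (2 - 3 * σ ^ 2) * (1 - σ * t + p * t ^ 2)) =
          ((2 + 4 * c) + σ * (1 - σ ^ 2 - 2 * p) * t) ^ 2 +
          (3 * (σ ^ 2) ^ 2 - 4 * σ ^ 2 + 1 - 4 * (p * c)) * (σ ^ 2 - 4 * p) * t ^ 2 := by
        subst hc; ring
      rw [e]
      have : 0 ≤ σ ^ 2 - 4 * p := by nlinarith [sq_nonneg σ]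
      positivity
    linarith [(mul_nonneg_iff_of_pos_left h0).1 key]

theorem hyperbolicUpToZeros_of_factors (h : c + p = σ ^ 2 - 1) (hp : p < 0) (hpc : p ≤ c)
    (hz : σ ^ 2 ≤ 2 / 3) (hR : 0 ≤ 3 * (σ ^ 2) ^ 2 - 4 * σ ^ 2 + 1 - 4 * (p * c))
    (hK : σ ^ 2 = 2 / 3 → p * c = -(1 / 12)) :
    HyperbolicUpToZeros (σ * (p - c)) (p * c) := by
  set r := Real.sqrt (σ ^ 2 - 4 * p)
  have hr : r ^ 2 = σ ^ 2 - 4 * p := Real.sq_sqrt (by nlinarith [sq_nonneg σ])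
  have hr0 : 0 ≤ r := Real.sqrt_nonneg _
  have hs : |σ| < r := by
    refine lt_of_pow_lt_pow_left₀ 2 hr0 ?_
    rw [sq_abs]; linarith
  obtain ⟨hs1, hs2⟩ := abs_lt.1 hs
  have hu : 0 < (σ + r) / 2 := by linarith
  have hv : (σ - r) / 2 < 0 := by linarith
  have hfac (t : ℝ) : 1 - σ * t + p * t ^ 2 =
      (1 - (σ + r) / 2 * t) * (1 - (σ - r) / 2 * t) := by
    linear_combination (t ^ 2 / 4) * hr
  refine ⟨((σ - r) / 2)⁻¹, ((σ + r) / 2)⁻¹, inv_lt_zero.2 hv, inv_pos.2 hu, ?_, ?_, ?_⟩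
  · rw [quartic_eq_mul h, hfac, mul_inv_cancel₀ hv.ne]; ring
  · rw [quartic_eq_mul h, hfac, mul_inv_cancel₀ hu.ne']; ring
  · rintro t ⟨hat, htb⟩
    have h1 : 0 < 1 - (σ + r) / 2 * t := by
      have := mul_lt_mul_of_pos_left htb hu
      rw [mul_inv_cancel₀ hu.ne'] at this
      linarith
    have h2 : 0 < 1 - (σ - r) / 2 * t := by
      have := mul_lt_mul_of_neg_left hat hv
      rw [mul_inv_cancel₀ hv.ne] at this
      linarith
    have hq1 : 0 < 1 - σ * t + p * t ^ 2 := by rw [hfac]; positivity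
    have hd : 0 < σ ^ 2 - 4 * p := by nlinarith [sq_nonneg σ]
    rcases hz.lt_or_eq with hz' | hz'
    · have hq2 : 0 < 1 + σ * t + c * t ^ 2 := by
        have := mul_le_second_factor h hp hpc hz hR t
        have h3 : 0 < (2 - 3 * σ ^ 2) * (1 - σ * t + p * t ^ 2) :=
          mul_pos (by linarith) hq1
        exact (mul_pos_iff_of_pos_left hd).1 (h3.trans_le this)
      have hf : 0 < quartic (σ * (p - c)) (p * c) t := by
        rw [quartic_eq_mul h]; positivity
      refine ⟨hf, ?_⟩
      rw [negHess_eq h]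
      have : 0 < 2 - 3 * σ ^ 2 := by linarith
      positivity
    · have hpc' := hK hz'
      have hsum : c = -1 / 3 - p := by linarith
      have hp2 : p = -1 / 2 := by
        have : (p + 1 / 2) * (p - 1 / 6) = 0 := by subst hsum; linarith
        rcases mul_eq_zero.1 this with h | h <;> linarith
      have hc2 : c = 1 / 6 := by linarith
      have hq2 : 1 + σ * t + c * t ^ 2 = (1 + σ * t / 2) ^ 2 := by
        rw [hc2]; linear_combination (-t ^ 2 / 4) * hz'
      have hne : 1 + σ * t / 2 ≠ 0 := by
        intro h0
        have : σ * t = -2 := by linarith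
        have ht : t ^ 2 = 6 := by
          have : (σ * t) ^ 2 = 4 := by rw [this]; norm_num
          rw [mul_pow, hz'] at this; linarith
        rw [this, ht, hp2] at hq1
        norm_num at hq1
      have hf : 0 < quartic (σ * (p - c)) (p * c) t := by
        rw [quartic_eq_mul h, hq2]; positivity
      refine ⟨hf, ?_⟩
      have hσ : σ ≠ 0 := by rintro rfl; norm_num at hz'
      have hN : 2 * σ + 2 * (c - p) * t - σ * (c + p) * t ^ 2 = 2 * σ * (1 + σ * t / 2) ^ 2 := by
        rw [hc2, hp2]
        linear_combination (-t * 2 - σ * t ^ 2 / 2) * hz'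
      rw [negHess_eq h, hN, hz']
      have : 0 < (2 * σ * (1 + σ * t / 2) ^ 2) ^ 2 := by positivity
      linarith

/-- If the two factors share a root `r` and the second one has no zero between `0` and `r`,
then the resolvent root is low. -/
theorem sq_le_of_common_root (h : c + p = σ ^ 2 - 1) (hp : p < 0) {r : ℝ} (hr : r ≠ 0)
    (h1 : 1 - σ * r + p * r ^ 2 = 0) (h2 : 1 + σ * r + c * r ^ 2 = 0)
    (hpos : ∀ s ∈ Set.Ioo (0 : ℝ) 1, 1 + σ * (s * r) + c * (s * r) ^ 2 ≠ 0) :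
    σ ^ 2 ≤ 2 / 3 ∧ (σ ^ 2 = 2 / 3 → p * c = -(1 / 12)) := by
  have hr2 : 0 < r ^ 2 := by positivity
  have hcr : c * r ^ 2 ≤ 1 := by
    by_contra! hlt
    refine hpos (c * r ^ 2)⁻¹ ⟨by positivity, inv_lt_one_of_one_lt₀ hlt⟩ ?_
    have : c * r ^ 2 ≠ 0 := by positivity
    have hc0 : c ≠ 0 := left_ne_zero_of_mul this
    field_simp
    linear_combination h2
  have hlo : -2 ≤ σ * r := by linarith
  have hhi : σ * r < 1 := by nlinarith
  have hzr : (1 - σ ^ 2) * r ^ 2 = 2 := by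
    linear_combination -h1 - h2 + r ^ 2 * h
  have h4 : (σ * r) ^ 2 ≤ 4 := by nlinarith
  have h6 : r ^ 2 ≤ 6 := by nlinarith
  refine ⟨?_, fun hz => ?_⟩
  · by_contra! hlt
    nlinarith
  · have hr6 : r ^ 2 = 6 := by rw [hz] at hzr; linarith
    have hσr : σ * r = -2 := by
      have : (σ * r + 2) * (σ * r - 2) = 0 := by
        have : (σ * r) ^ 2 = 4 := by rw [mul_pow, hz, hr6]; norm_num
        linear_combination this
      rcases mul_eq_zero.1 this with h | h <;> linarith
    have hc : c = 1 / 6 := by rw [hr6, hσr] at h2; linarith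
    have hp : p = -1 / 2 := by rw [hr6, hσr] at h1; linarith
    rw [hc, hp]; norm_num

end Algebra

theorem hyperbolicUpToZeros_of_lowResolventRoot {L K : ℝ} (h : LowResolventRoot L K) :
    HyperbolicUpToZeros L K := by
  obtain ⟨z, hz0, hL, hR, hz, hK⟩ := h
  have hdisc : 0 ≤ (z - 1) ^ 2 - 4 * K := by
    rcases hz0.eq_or_lt with rfl | hz0
    · linarith
    · exact (mul_nonneg_iff_of_pos_left hz0).1 (hL ▸ sq_nonneg L)
  set d := Real.sqrt ((z - 1) ^ 2 - 4 * K)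
  have hd : d ^ 2 = (z - 1) ^ 2 - 4 * K := Real.sq_sqrt hdisc
  have hd0 : 0 ≤ d := Real.sqrt_nonneg _
  obtain ⟨σ, hσ, hσL⟩ : ∃ σ : ℝ, σ ^ 2 = z ∧ σ * -d = L := by
    have hsq := Real.sq_sqrt hz0
    have hLd : (Real.sqrt z * d) ^ 2 = L ^ 2 := by rw [mul_pow, hsq, hd, hL]
    rcases sq_eq_sq_iff_eq_or_eq_neg.1 hLd with h | h
    · exact ⟨-Real.sqrt z, by rw [neg_sq, hsq], by linarith⟩
    · exact ⟨Real.sqrt z, hsq, by linarith⟩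
  have hKpc : (z - 1 - d) / 2 * ((z - 1 + d) / 2) = K := by linear_combination -hd / 4
  have key := hyperbolicUpToZeros_of_factors (σ := σ) (c := (z - 1 + d) / 2)
    (p := (z - 1 - d) / 2) (by rw [hσ]; ring) (by linarith) (by linarith) (by rwa [hσ])
    (by rwa [hσ, hKpc]) (by rwa [hσ, hKpc])
  rwa [hKpc, show (z - 1 - d) / 2 - (z - 1 + d) / 2 = -d by ring, hσL] at key

theorem lowResolventRoot_of_hyperbolicUpToZeros {L K : ℝ} (h : HyperbolicUpToZeros L K) :
    LowResolventRoot L K := by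
  obtain ⟨a, b, ha, hb, hfa, hfb, hpos⟩ := h
  obtain ⟨σ, hσ⟩ : ∃ σ, σ = a⁻¹ + b⁻¹ := ⟨_, rfl⟩
  obtain ⟨p, hp⟩ : ∃ p, p = a⁻¹ * b⁻¹ := ⟨_, rfl⟩
  obtain ⟨c, hc⟩ : ∃ c, c = σ ^ 2 - 1 - p := ⟨_, rfl⟩
  have hsum : c + p = σ ^ 2 - 1 := by linarith
  have hp0 : p < 0 := hp ▸ mul_neg_of_neg_of_pos (inv_lt_zero.2 ha) (inv_pos.2 hb)
  have ha0 := ha.ne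
  have hb0 := hb.ne'
  have hq1 (t : ℝ) : 1 - σ * t + p * t ^ 2 = (1 - a⁻¹ * t) * (1 - b⁻¹ * t) := by
    rw [hσ, hp]; ring
  have hq1a : 1 - σ * a + p * a ^ 2 = 0 := by rw [hq1, inv_mul_cancel₀ ha0]; ring
  have hq1b : 1 - σ * b + p * b ^ 2 = 0 := by rw [hq1, inv_mul_cancel₀ hb0]; ring
  have hfa' : quartic (σ * (p - c)) (p * c) a = 0 := by rw [quartic_eq_mul hsum, hq1a]; ring
  have hfb' : quartic (σ * (p - c)) (p * c) b = 0 := by rw [quartic_eq_mul hsum, hq1b]; ring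
  have hab : b - a ≠ 0 := by linarith
  unfold quartic at hfa hfb hfa' hfb'
  have eA : (L - σ * (p - c)) + (K - p * c) * a = 0 := by
    have : a ^ 3 * ((L - σ * (p - c)) + (K - p * c) * a) = 0 := by
      linear_combination hfa - hfa'
    exact (mul_eq_zero.1 this).resolve_left (pow_ne_zero _ ha0)
  have eB : (L - σ * (p - c)) + (K - p * c) * b = 0 := by
    have : b ^ 3 * ((L - σ * (p - c)) + (K - p * c) * b) = 0 := by
      linear_combination hfb - hfb'
    exact (mul_eq_zero.1 this).resolve_left (pow_ne_zero _ hb0)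
  have hK : K = p * c := by
    have : (b - a) * (K - p * c) = 0 := by linear_combination eB - eA
    linarith [(mul_eq_zero.1 this).resolve_left hab]
  have hL : L = σ * (p - c) := by rw [hK] at eA; linarith
  subst hK hL
  have hq1pos : ∀ t ∈ Set.Ioo a b, 0 < 1 - σ * t + p * t ^ 2 := by
    rintro t ⟨hat, htb⟩
    have h1 : 0 < 1 - a⁻¹ * t := by
      have := mul_lt_mul_of_neg_left hat (inv_lt_zero.2 ha)
      rw [inv_mul_cancel₀ ha0] at this
      linarith
    have h2 : 0 < 1 - b⁻¹ * t := by
      have := mul_lt_mul_of_pos_left htb (inv_pos.2 hb)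
      rw [inv_mul_cancel₀ hb0] at this
      linarith
    rw [hq1]; positivity
  have hq2pos : ∀ t ∈ Set.Ioo a b, 0 < 1 + σ * t + c * t ^ 2 := by
    intro t ht
    have := (hpos t ht).1
    rw [quartic_eq_mul hsum] at this
    exact (mul_pos_iff_of_pos_left (hq1pos t ht)).1 this
  have hq2nn : ∀ t ∈ Set.Icc a b, 0 ≤ 1 + σ * t + c * t ^ 2 := by
    intro t ht
    rw [← closure_Ioo (by linarith)] at ht
    have hcl : IsClosed {t : ℝ | 0 ≤ 1 + σ * t + c * t ^ 2} :=
      isClosed_le continuous_const (by fun_prop)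
    exact closure_minimal (fun t ht => (hq2pos t ht).le) hcl ht
  have hq2a := hq2nn a ⟨le_rfl, by linarith⟩
  have hq2b := hq2nn b ⟨by linarith, le_rfl⟩
  have hlow : σ ^ 2 ≤ 2 / 3 ∧ (σ ^ 2 = 2 / 3 → p * c = -(1 / 12)) := by
    rcases hq2a.eq_or_lt with hq2a | hq2a
    · refine sq_le_of_common_root hsum hp0 ha0 hq1a hq2a.symm fun s hs => ?_
      exact (hq2pos _ ⟨by nlinarith [hs.1, hs.2], by nlinarith [hs.1, hs.2]⟩).ne'
    rcases hq2b.eq_or_lt with hq2b | hq2b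
    · refine sq_le_of_common_root hsum hp0 hb0 hq1b hq2b.symm fun s hs => ?_
      exact (hq2pos _ ⟨by nlinarith [hs.1, hs.2], by nlinarith [hs.1, hs.2]⟩).ne'
    have hda : 0 < -σ + 2 * p * a := by
      have : -σ + 2 * p * a = b⁻¹ - a⁻¹ := by rw [hσ, hp]; field_simp; ring
      rw [this]; linarith [inv_lt_zero.2 ha, inv_pos.2 hb]
    have hdb : -σ + 2 * p * b < 0 := by
      have : -σ + 2 * p * b = a⁻¹ - b⁻¹ := by rw [hσ, hp]; field_simp; ring
      rw [this]; linarith [inv_lt_zero.2 ha, inv_pos.2 hb]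
    have hN (t : ℝ) : 2 * σ + 2 * (c - p) * t - σ * (c + p) * t ^ 2 =
        (σ + 2 * c * t) * (1 - σ * t + p * t ^ 2) -
          (1 + σ * t + c * t ^ 2) * (-σ + 2 * p * t) := by ring
    obtain ⟨t, ht, ht0⟩ : (0 : ℝ) ∈ (fun t : ℝ => 2 * σ + 2 * (c - p) * t -
        σ * (c + p) * t ^ 2) '' Set.Ioo a b := by
      refine intermediate_value_Ioo (by linarith) (by fun_prop) ⟨?_, ?_⟩
      · simp only [hN, hq1a]; nlinarith
      · simp only [hN, hq1b]; nlinarith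
    have hf := (hpos t ht).1
    have hE := (hpos t ht).2
    beta_reduce at ht0
    rw [negHess_eq hsum, ht0] at hE
    have : 0 < 2 - 3 * σ ^ 2 := by
      by_contra! hle
      nlinarith [mul_nonneg (sub_nonneg.2 hle) hf.le]
    exact ⟨by linarith, fun h => by linarith⟩
  refine ⟨σ ^ 2, sq_nonneg σ, ?_, ?_, hlow.1, hlow.2⟩
  · have : c = σ ^ 2 - 1 - p := hc
    subst this; ring
  · have hres : 3 * (σ ^ 2) ^ 2 - 4 * σ ^ 2 + 1 - 4 * (p * c) =
        p ^ 2 * ((1 + σ * a + c * a ^ 2) * (1 + σ * b + c * b ^ 2)) := by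
      rw [hc, hp, hσ]; field_simp; ring
    rw [hres]; positivity

theorem abs_le_iff_exists_resolvent {L K : ℝ} (hK : -(1 / 12) ≤ K) :
    (K ≤ 1 / 4 ∧ |L| ≤ Real.sqrt 2 / (3 * Real.sqrt 3) *
      Real.sqrt (1 - 36 * K + Real.sqrt ((1 + 12 * K) ^ 3))) ↔
    LowResolventRoot L K := by
  set s := Real.sqrt (1 + 12 * K)
  have hs0 : 0 ≤ s := Real.sqrt_nonneg _
  have hs : s ^ 2 = 1 + 12 * K := Real.sq_sqrt (by linarith)
  have hKs : K = (s ^ 2 - 1) / 12 := by linarith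
  have hcube : Real.sqrt ((1 + 12 * K) ^ 3) = s ^ 3 := by
    rw [← hs, ← Real.sqrt_sq (pow_nonneg hs0 3)]; congr 1; ring
  set U := Real.sqrt 2 / (3 * Real.sqrt 3) * Real.sqrt (1 - 36 * K + Real.sqrt ((1 + 12 * K) ^ 3))
  have hU0 : 0 ≤ U := by positivity
  have hU : U ^ 2 = (2 - s) / 3 * (((2 - s) / 3 - 1) ^ 2 - 4 * K) := by
    have hrad : 0 ≤ 1 - 36 * K + s ^ 3 := by
      have : 1 - 36 * K + s ^ 3 = (2 - s) ^ 2 * (1 + s) := by rw [hKs]; ring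
      rw [this]; positivity
    simp only [U]
    rw [hcube, mul_pow, div_pow, mul_pow, Real.sq_sqrt hrad, Real.sq_sqrt (by norm_num),
      Real.sq_sqrt (by norm_num), hKs]
    ring
  have hLU : |L| ≤ U ↔ L ^ 2 ≤ (2 - s) / 3 * (((2 - s) / 3 - 1) ^ 2 - 4 * K) := by
    rw [← hU, sq_le_sq, abs_of_nonneg hU0]
  rw [hLU]
  constructor
  · rintro ⟨hK4, hL⟩
    have hs2 : s ≤ 2 := by nlinarith
    obtain ⟨z, ⟨hz0, hz⟩, hzL⟩ := intermediate_value_Icc (a := 0) (b := (2 - s) / 3)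
      (f := fun z : ℝ => z * ((z - 1) ^ 2 - 4 * K)) (by linarith) (by fun_prop)
      ⟨by simpa using sq_nonneg L, hL⟩
    refine ⟨z, hz0, hzL, ?_, by linarith, fun h => ?_⟩
    · have : 3 * z ^ 2 - 4 * z + 1 - 4 * K = 3 * (((2 - s) / 3 - z) * ((2 + s) / 3 - z)) := by
        rw [hKs]; ring
      rw [this]
      exact mul_nonneg (by norm_num) (mul_nonneg (by linarith) (by linarith))
    · have : s = 0 := by linarith
      rw [hKs, this]; norm_num
  · rintro ⟨z, hz0, hzL, hR, hz, hzK⟩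
    have hzs : z ≤ (2 - s) / 3 := by
      by_contra! hlt
      have : 3 * z ^ 2 - 4 * z + 1 - 4 * K = 3 * ((z - (2 - s) / 3) * (z - (2 + s) / 3)) := by
        rw [hKs]; ring
      have h1 : 0 ≤ z - (2 + s) / 3 := by
        rw [this] at hR
        exact (mul_nonneg_iff_of_pos_left (sub_pos.2 hlt)).1 (by linarith)
      linarith
    refine ⟨by nlinarith, ?_⟩
    have : (2 - s) / 3 * (((2 - s) / 3 - 1) ^ 2 - 4 * K) - L ^ 2 =
        (z - (2 - s) / 3) ^ 2 * (2 - 2 * ((2 - s) / 3) - z) := by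
      rw [← hzL, hKs]; ring
    have h2 : 0 ≤ (z - (2 - s) / 3) ^ 2 * (2 - 2 * ((2 - s) / 3) - z) :=
      mul_nonneg (sq_nonneg _) (by linarith)
    linarith

theorem abs_lt_iff_exists_resolvent {L K : ℝ} (hK : K < -(1 / 12)) :
    |L| < Real.sqrt (6 - 216 * K) / 9 ↔ LowResolventRoot L K := by
  have hW : (Real.sqrt (6 - 216 * K) / 9) ^ 2 = 2 / 3 * ((2 / 3 - 1) ^ 2 - 4 * K) := by
    rw [div_pow, Real.sq_sqrt (by linarith)]; ring
  have hLW : |L| < Real.sqrt (6 - 216 * K) / 9 ↔ L ^ 2 < 2 / 3 * ((2 / 3 - 1) ^ 2 - 4 * K) := by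
    rw [← hW, sq_lt_sq, abs_of_nonneg (a := Real.sqrt (6 - 216 * K) / 9) (by positivity)]
  rw [hLW]
  constructor
  · intro hL
    obtain ⟨z, ⟨hz0, hz⟩, hzL⟩ := intermediate_value_Icc (a := 0) (b := 2 / 3)
      (f := fun z : ℝ => z * ((z - 1) ^ 2 - 4 * K)) (by norm_num) (by fun_prop)
      ⟨by simpa using sq_nonneg L, hL.le⟩
    refine ⟨z, hz0, hzL, by nlinarith [sq_nonneg (3 * z - 2)], hz, ?_⟩
    rintro rfl
    exact absurd hzL hL.ne'
  · rintro ⟨z, hz0, hzL, -, hz, hzK⟩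
    have hz' : z < 2 / 3 := hz.lt_of_ne fun h => hK.ne (hzK h)
    have : 2 / 3 * ((2 / 3 - 1) ^ 2 - 4 * K) - L ^ 2 =
        (2 / 3 - z) * ((2 / 3 - z) ^ 2 + (-4 * K - 1 / 3)) := by
      rw [← hzL]; ring
    have : 0 < (2 / 3 - z) * ((2 / 3 - z) ^ 2 + (-4 * K - 1 / 3)) :=
      mul_pos (by linarith) (by nlinarith [sq_nonneg (2 / 3 - z)])
    linarith

theorem hessDet2_hLK (L K : ℝ) (v : Fin 2 → ℝ) :
    hessDet2 (hLK L K) v =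
      (12 * v 0 ^ 2 - 2 * v 1 ^ 2) * (-2 * v 0 ^ 2 + 6 * L * v 0 * v 1 + 12 * K * v 1 ^ 2) -
        (-4 * v 0 * v 1 + 3 * L * v 1 ^ 2) ^ 2 := by
  have hc (i : Fin 2) (w : Fin 2 → ℝ) :
      HasFDerivAt (fun v : Fin 2 → ℝ => v i) (ContinuousLinearMap.proj (R := ℝ) i) w :=
    (ContinuousLinearMap.proj (R := ℝ) (φ := fun _ : Fin 2 => ℝ) i).hasFDerivAt
  have hd : fderiv ℝ (hLK L K) = fun w : Fin 2 → ℝ =>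
      (4 * w 0 ^ 3 - 2 * w 0 * w 1 ^ 2 + L * w 1 ^ 3) • ContinuousLinearMap.proj (R := ℝ) 0 +
      (-2 * w 0 ^ 2 * w 1 + 3 * L * w 0 * w 1 ^ 2 + 4 * K * w 1 ^ 3) •
        ContinuousLinearMap.proj (R := ℝ) 1 := by
    funext w
    refine HasFDerivAt.fderiv ?_
    unfold hLK
    refine (((((hc 0 w).pow 4).sub (((hc 0 w).pow 2).mul ((hc 1 w).pow 2))).add
      (((hc 0 w).const_mul L).mul ((hc 1 w).pow 3))).add
      (((hc 1 w).pow 4).const_mul K)).congr_fderiv ?_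
    ext x
    simp
    ring
  have hx : HasFDerivAt (fun w : Fin 2 → ℝ => 4 * w 0 ^ 3 - 2 * w 0 * w 1 ^ 2 + L * w 1 ^ 3)
      ((12 * v 0 ^ 2 - 2 * v 1 ^ 2) • ContinuousLinearMap.proj (R := ℝ) 0 +
        (-4 * v 0 * v 1 + 3 * L * v 1 ^ 2) • ContinuousLinearMap.proj (R := ℝ) 1) v := by
    refine (((((hc 0 v).pow 3).const_mul 4).sub (((hc 0 v).const_mul 2).mul
      ((hc 1 v).pow 2))).add (((hc 1 v).pow 3).const_mul L)).congr_fderiv ?_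
    ext x
    simp
    ring
  have hy : HasFDerivAt
      (fun w : Fin 2 → ℝ => -2 * w 0 ^ 2 * w 1 + 3 * L * w 0 * w 1 ^ 2 + 4 * K * w 1 ^ 3)
      ((-4 * v 0 * v 1 + 3 * L * v 1 ^ 2) • ContinuousLinearMap.proj (R := ℝ) 0 +
        (-2 * v 0 ^ 2 + 6 * L * v 0 * v 1 + 12 * K * v 1 ^ 2) •
          ContinuousLinearMap.proj (R := ℝ) 1) v := by
    refine (((((hc 0 v).pow 2).const_mul (-2)).mul (hc 1 v)).add
      (((hc 0 v).const_mul (3 * L)).mul ((hc 1 v).pow 2)) |>.add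
      (((hc 1 v).pow 3).const_mul (4 * K))).congr_fderiv ?_
    ext x
    simp
    ring
  have h2 := (hx.smul_const (ContinuousLinearMap.proj (R := ℝ) (φ := fun _ : Fin 2 => ℝ) 0)).add
    (hy.smul_const (ContinuousLinearMap.proj (R := ℝ) (φ := fun _ : Fin 2 => ℝ) 1))
  have h2' := h2.fderiv
  simp only [hessDet2, Matrix.det_fin_two, Matrix.of_apply, iteratedFDeriv_two_apply, hd]
  erw [h2']
  simp
  ring

theorem hLK_smul (L K : ℝ) (r : ℝ) (t : ℝ) :
    hLK L K ![r, r * t] = r ^ 4 * quartic L K t := by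
  simp [hLK, quartic]; ring

theorem hessDet2_smul (L K : ℝ) (r : ℝ) (t : ℝ) :
    hessDet2 (hLK L K) ![r, r * t] = -3 * r ^ 4 * negHess L K t := by
  simp [hessDet2_hLK, negHess]; ring

/-- The radial projection of `(1, t)` to the level set `hLK L K = 1`. -/
def radialPoint (L K t : ℝ) : Fin 2 → ℝ :=
  ![quartic L K t ^ (-(1 / 4) : ℝ), quartic L K t ^ (-(1 / 4) : ℝ) * t]

theorem continuousAt_radialPoint {L K t : ℝ} (ht : 0 < quartic L K t) :
    ContinuousAt (radialPoint L K) t := by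
  have h : ContinuousAt (fun t => quartic L K t ^ (-(1 / 4) : ℝ)) t :=
    (quartic_continuous L K).continuousAt.rpow_const (Or.inl ht.ne')
  refine continuousAt_pi.2 fun i => ?_
  fin_cases i
  · exact h
  · exact h.mul continuousAt_id

theorem radialPoint_zero (L K : ℝ) : radialPoint L K 0 = ![1, 0] := by
  simp [radialPoint, quartic]

theorem rpow_neg_quarter_pow {x : ℝ} (hx : 0 < x) : (x ^ (-(1 / 4) : ℝ)) ^ 4 * x = 1 := by
  rw [← Real.rpow_natCast, ← Real.rpow_mul hx.le]
  norm_num [Real.rpow_neg_one, hx.ne']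

theorem radialPoint_mem_iff {L K t : ℝ} (ht : 0 < quartic L K t) :
    radialPoint L K t ∈ {p | hLK L K p = 1 ∧ hessDet2 (hLK L K) p < 0} ↔
      0 < negHess L K t := by
  have hr : 0 < (quartic L K t ^ (-(1 / 4) : ℝ)) ^ 4 := pow_pos (Real.rpow_pos_of_pos ht _) 4
  simp only [Set.mem_ofPred_eq, radialPoint, hLK_smul, hessDet2_smul,
    rpow_neg_quarter_pow ht, true_and]
  constructor <;> intro h
  · by_contra! hn
    nlinarith
  · nlinarith [mul_pos hr h]

theorem radialPoint_image_subset {L K : ℝ} {s : Set ℝ} (hs : s.OrdConnected) (h0 : 0 ∈ s)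
    (h : ∀ t ∈ s, 0 < quartic L K t ∧ 0 < negHess L K t) :
    radialPoint L K '' s ⊆ Hcurve L K := by
  refine IsPreconnected.subset_connectedComponentIn ?_ ⟨0, h0, radialPoint_zero L K⟩ ?_
  · exact hs.isPreconnected.image _ fun t ht =>
      (continuousAt_radialPoint (h t ht).1).continuousWithinAt
  · rintro _ ⟨t, ht, rfl⟩
    exact (radialPoint_mem_iff (h t ht).1).2 (h t ht).2

theorem Hcurve_subset (L K : ℝ) :
    Hcurve L K ⊆ {p | hLK L K p = 1 ∧ hessDet2 (hLK L K) p < 0} :=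
  connectedComponentIn_subset _ _

theorem isClosed_Hcurve {L K : ℝ} (h : HyperbolicUpToZeros L K) : IsClosed (Hcurve L K) := by
  obtain ⟨a, b, ha, hb, hfa, hfb, hpos⟩ := h
  have hcone (p : Fin 2 → ℝ) (hp : hLK L K p = 1) (h0 : 0 ≤ p 0) (h1 : a * p 0 ≤ p 1)
      (h2 : p 1 ≤ b * p 0) : 0 < p 0 ∧ a * p 0 < p 1 ∧ p 1 < b * p 0 := by
    have hp' : hLK L K ![p 0, p 1] = 1 := by
      rw [← hp]; simp [hLK]
    refine ⟨h0.lt_of_ne fun h => ?_, h1.lt_of_ne fun h => ?_, h2.lt_of_ne fun h => ?_⟩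
    · have h3 : p 1 = 0 := by rw [← h] at h1 h2; linarith
      simp [hLK, ← h, h3] at hp'
    · rw [← h, mul_comm, hLK_smul, hfa] at hp'
      simp at hp'
    · rw [h, mul_comm, hLK_smul, hfb] at hp'
      simp at hp'
  set C : Set (Fin 2 → ℝ) := {p | (0 ≤ p 0 ∧ a * p 0 ≤ p 1 ∧ p 1 ≤ b * p 0) ∧ hLK L K p = 1}
  have hcont : Continuous (hLK L K) := by unfold hLK; fun_prop
  have hKclosed : IsClosed {p : Fin 2 → ℝ | 0 ≤ p 0 ∧ a * p 0 ≤ p 1 ∧ p 1 ≤ b * p 0} :=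
    .and (isClosed_le (by fun_prop) (by fun_prop))
      (.and (isClosed_le (by fun_prop) (by fun_prop)) (isClosed_le (by fun_prop) (by fun_prop)))
  have hUopen : IsOpen {p : Fin 2 → ℝ | 0 < p 0 ∧ a * p 0 < p 1 ∧ p 1 < b * p 0} :=
    .and (isOpen_lt (by fun_prop) (by fun_prop))
      (.and (isOpen_lt (by fun_prop) (by fun_prop)) (isOpen_lt (by fun_prop) (by fun_prop)))
  have hbase : ![1, 0] ∈ {p | hLK L K p = 1 ∧ hessDet2 (hLK L K) p < 0} := by
    simp [hLK, hessDet2_hLK]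
  have hC : IsClosed C := hKclosed.inter (isClosed_eq hcont continuous_const)
  suffices Hcurve L K = C by rwa [this]
  refine Set.Subset.antisymm ?_ ?_
  · have hsub := Hcurve_subset L K
    have := IsPreconnected.subset_left_of_subset_union hUopen hKclosed.isOpen_compl
      (Set.disjoint_left.2 fun p hp hp' => hp' ⟨hp.1.le, hp.2.1.le, hp.2.2.le⟩)
      (s := Hcurve L K) (fun p hp => ?_)
      ⟨![1, 0], mem_connectedComponentIn hbase, by simp, by simpa, by simpa⟩
      isPreconnected_connectedComponentIn
    · intro p hp
      have hp' := this hp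
      exact ⟨⟨hp'.1.le, hp'.2.1.le, hp'.2.2.le⟩, (hsub hp).1⟩
    · by_cases hpK : p ∈ {p : Fin 2 → ℝ | 0 ≤ p 0 ∧ a * p 0 ≤ p 1 ∧ p 1 ≤ b * p 0}
      · exact Or.inl (hcone p (hsub hp).1 hpK.1 hpK.2.1 hpK.2.2)
      · exact Or.inr hpK
  · rintro p ⟨⟨h0, h1, h2⟩, hp⟩
    obtain ⟨h0, h1, h2⟩ := hcone p hp h0 h1 h2
    have ht : p 1 / p 0 ∈ Set.Ioo a b := ⟨(lt_div_iff₀ h0).2 h1, (div_lt_iff₀ h0).2 h2⟩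
    refine radialPoint_image_subset Set.ordConnected_Ioo ⟨ha, hb⟩ hpos ⟨_, ht, ?_⟩
    have hpe : p = ![p 0, p 0 * (p 1 / p 0)] := by
      rw [mul_div_cancel₀ _ h0.ne']
      ext i; fin_cases i <;> rfl
    have hq : p 0 ^ 4 * quartic L K (p 1 / p 0) = 1 := by
      rw [← hLK_smul, ← hpe, hp]
    have hr : quartic L K (p 1 / p 0) ^ (-(1 / 4) : ℝ) = p 0 := by
      have hq0 := (hpos _ ht).1
      refine (pow_left_inj₀ (Real.rpow_nonneg hq0.le _) h0.le (by norm_num : 4 ≠ 0)).1 ?_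
      exact mul_right_cancel₀ hq0.ne' ((rpow_neg_quarter_pow hq0).trans hq.symm)
    rw [radialPoint, hr, ← hpe]

/-- Along a ray of slopes, positivity or hyperbolicity must fail eventually. -/
theorem exists_nonpos (L K : ℝ) : ∃ t, 0 ≤ t ∧ (quartic L K t ≤ 0 ∨ negHess L K t ≤ 0) := by
  by_contra! hpos
  have hK : 0 ≤ K := by
    by_contra! hK
    obtain ⟨t, htdef⟩ : ∃ t, t = 1 + |L| / -K := ⟨_, rfl⟩
    have ht : 1 ≤ t := by
      have : 0 ≤ |L| / -K := div_nonneg (abs_nonneg L) (by linarith)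
      linarith
    have hLK : L + K * t ≤ 0 := by
      have : K * t = K - |L| := by
        have hK0 := hK.ne
        rw [htdef]; field_simp; ring
      linarith [le_abs_self L]
    have h1 := (hpos t (by linarith)).1
    have h2 : t ^ 3 * (L + K * t) ≤ 0 := mul_nonpos_of_nonneg_of_nonpos (by positivity) hLK
    unfold quartic at h1
    nlinarith
  have h2 := (hpos 2 (by norm_num)).1
  unfold quartic at h2
  obtain ⟨t, ⟨ht0, -⟩, ht⟩ := intermediate_value_Icc (a := 0) (b := 2)
    (f := fun t : ℝ => -2 + 3 * L * t + 4 * K * t ^ 2) (by norm_num) (by fun_prop)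
    (show (0 : ℝ) ∈ _ from ⟨by norm_num, by linarith⟩)
  beta_reduce at ht
  have hE := (hpos t ht0).2
  have hf := (hpos t ht0).1
  have : negHess L K t = -4 * quartic L K t * (2 + 4 * K * t ^ 2) +
      3 * t ^ 2 * (-2 + 3 * L * t + 4 * K * t ^ 2) ^ 2 -
      8 * quartic L K t * (-2 + 3 * L * t + 4 * K * t ^ 2) := by
    unfold negHess quartic; ring
  rw [this, ht] at hE
  have : 0 < quartic L K t * (2 + 4 * K * t ^ 2) := by positivity
  linarith

theorem exists_zero_of_isClosed {L K : ℝ} (h : IsClosed (Hcurve L K)) {e : ℝ}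
    (he : e ^ 2 = 1) :
    ∃ b, 0 < b ∧ quartic L K (e * b) = 0 ∧
      ∀ t ∈ Set.Ico 0 b, 0 < quartic L K (e * t) ∧ 0 < negHess L K (e * t) := by
  have hq : Continuous fun t => quartic L K (e * t) := (quartic_continuous L K).comp (by fun_prop)
  have hn : Continuous fun t => negHess L K (e * t) := (negHess_continuous L K).comp (by fun_prop)
  set Z : Set ℝ := {t | 0 ≤ t ∧ (quartic L K (e * t) ≤ 0 ∨ negHess L K (e * t) ≤ 0)}
  have hZc : IsClosed Z := (isClosed_le continuous_const continuous_id).inter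
    ((isClosed_le hq continuous_const).union (isClosed_le hn continuous_const))
  have hZne : Z.Nonempty := by
    obtain ⟨t, ht, h⟩ := exists_nonpos (e * L) K
    have h3 : e ^ 3 = e := by rw [pow_succ, he, one_mul]
    have h4 : e ^ 4 = 1 := by rw [pow_succ, h3, ← sq, he]
    have hqe : quartic L K (e * t) = quartic (e * L) K t := by
      simp only [quartic, mul_pow, he, h3, h4]; ring
    have hne : negHess L K (e * t) = negHess (e * L) K t := by
      simp only [negHess, mul_pow, he, h3, h4]; ring
    exact ⟨t, ht, by rwa [hqe, hne]⟩
  have hZb : BddBelow Z := ⟨0, fun t ht => ht.1⟩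
  set b := sInf Z
  have hbZ : b ∈ Z := hZc.csInf_mem hZne hZb
  have hb : 0 < b := by
    refine hbZ.1.lt_of_ne fun h0 => ?_
    have := hbZ.2
    rw [← h0] at this
    norm_num [quartic, negHess] at this
  have hpos : ∀ t ∈ Set.Ico 0 b, 0 < quartic L K (e * t) ∧ 0 < negHess L K (e * t) := by
    intro t ht
    by_contra hcon
    refine notMem_of_lt_csInf ht.2 hZb ⟨ht.1, ?_⟩
    by_contra! hcon'
    exact hcon hcon'
  have hbcl : b ∈ closure (Set.Ico 0 b) := by
    rw [closure_Ico hb.ne]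
    exact ⟨hb.le, le_rfl⟩
  refine ⟨b, hb, ?_, hpos⟩
  have hfb : 0 ≤ quartic L K (e * b) :=
    closure_minimal (fun t ht => (hpos t ht).1.le) (isClosed_le continuous_const hq) hbcl
  refine (hfb.eq_of_not_lt fun hfb => ?_).symm
  have hmaps : Set.MapsTo (fun t => radialPoint L K (e * t)) (Set.Ico 0 b) (Hcurve L K) := by
    have hord : ((fun t => e * t) '' Set.Ico 0 b).OrdConnected :=
      (isPreconnected_Ico.image _ (by fun_prop)).ordConnected
    intro t ht
    refine radialPoint_image_subset hord ⟨0, ⟨le_rfl, hb⟩, by simp⟩ ?_ ⟨_, ⟨t, ht, rfl⟩, rfl⟩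
    rintro _ ⟨s, hs, rfl⟩
    exact hpos s hs
  have hcont : ContinuousAt (fun t => radialPoint L K (e * t)) b :=
    ContinuousAt.comp (f := fun t => e * t) (continuousAt_radialPoint hfb) (by fun_prop)
  have hmem : radialPoint L K (e * b) ∈ Hcurve L K :=
    h.closure_subset (hcont.continuousWithinAt.mem_closure hbcl hmaps)
  have := (radialPoint_mem_iff hfb).1 (Hcurve_subset L K hmem)
  rcases hbZ.2 with h | h <;> linarith

theorem isClosed_Hcurve_iff (L K : ℝ) : IsClosed (Hcurve L K) ↔ HyperbolicUpToZeros L K := by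
  refine ⟨fun h => ?_, isClosed_Hcurve⟩
  obtain ⟨b, hb, hfb, hposb⟩ := exists_zero_of_isClosed h (e := 1) (by norm_num)
  obtain ⟨a, ha, hfa, hposa⟩ := exists_zero_of_isClosed h (e := -1) (by norm_num)
  simp only [one_mul, neg_one_mul] at hfb hposb hfa hposa
  refine ⟨-a, b, by linarith, hb, hfa, hfb, fun t ht => ?_⟩
  rcases le_total 0 t with h0 | h0
  · exact hposb t ⟨h0, ht.2⟩
  · simpa using hposa (-t) ⟨by linarith, by linarith [ht.1]⟩

/-- **Characterization of closedness of `H_{L,K}`.**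
With `u(K) = (√2/(3√3))·√(1 − 36K + √((1+12K)³))` and `w(K) = √(6 − 216K)/9`,
the curve `H_{L,K}` is closed in ℝ² iff `(−1/12 ≤ K ≤ 1/4 and |L| ≤ u(K))` or
`(K < −1/12 and |L| < w(K))`. -/
theorem closedness_characterization (L K : ℝ) :
    IsClosed (Hcurve L K) ↔
      ((-(1/12) ≤ K ∧ K ≤ 1/4 ∧
          |L| ≤ Real.sqrt 2 / (3 * Real.sqrt 3) *
            Real.sqrt (1 - 36 * K + Real.sqrt ((1 + 12 * K) ^ 3))) ∨
        (K < -(1/12) ∧ |L| < Real.sqrt (6 - 216 * K) / 9)) := by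
  rw [isClosed_Hcurve_iff, show HyperbolicUpToZeros L K ↔ LowResolventRoot L K from
    ⟨lowResolventRoot_of_hyperbolicUpToZeros, hyperbolicUpToZeros_of_lowResolventRoot⟩]
  rcases lt_or_ge K (-(1 / 12)) with hK | hK
  · rw [← abs_lt_iff_exists_resolvent hK]
    simp only [hK, hK.not_ge, false_and, true_and, false_or]
  · rw [← abs_le_iff_exists_resolvent hK]
    simp only [hK, hK.not_gt, false_and, true_and, or_false]
end
end
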